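/- There exists a constant c > 0 such that for almost every α ∈ [0,1) there are infinitely many N ∈ ℕ with T(α, 10N, 1) ≥ c·(log N)^{1/10}. In particular, for almost every α ∈ [0,1), limsup_{N→∞} T(α, N, 1) = ∞, so the sequence of sums of two squares has no Poissonian pair correlation at almost every α. -/

import Mathlib

open Real MeasureTheory Filter Finset
open scoped Classical

/-- `n` is a sum of two squares. -/
def IsSumTwoSquares (n : ℕ) : Prop := ∃ x y : ℤ, (n : ℤ) = x ^ 2 + y ^ 2

/-- Indicator function of the sums of two squares. -/
noncomputable def b (n : ℕ) : ℕ := if IsSumTwoSquares n then 1 else 0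

/-- `a n` is the `n`-th (1-indexed) natural number that is a sum of two squares,
in strictly increasing order. -/
noncomputable def a (n : ℕ) : ℕ := Nat.nth IsSumTwoSquares (n - 1)

/-- Distance to the nearest integer. -/
noncomputable def nint (x : ℝ) : ℝ := |x - round x|

/-- `R N v` counts pairs `1 ≤ n < m ≤ N` with `a m - a n = v`. -/
noncomputable def R (N v : ℕ) : ℕ :=
  ((Finset.Icc 1 N ×ˢ Finset.Icc 1 N).filter
    (fun p => p.1 < p.2 ∧ a p.2 - a p.1 = v)).card

/-- The pair correlation function
`T(α,N,s) = (1/N) Σ_{v ≥ 1} R_N(v)·1[‖vα‖ ≤ s/N]`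
(the sum is finite since `R N v = 0` for `v > a N`). -/
noncomputable def T (α : ℝ) (N : ℕ) (s : ℝ) : ℝ :=
  (1 / N) * ∑ v ∈ Finset.Icc 1 (a N),
    (R N v : ℝ) * (if nint (v * α) ≤ s / N then 1 else 0)

/-- The nontrivial Dirichlet character modulo `4`, with real values. -/
noncomputable def chi (n : ℕ) : ℝ := ((ZMod.χ₄ (n : ZMod 4) : ℤ) : ℝ)

lemma chi_eq (n : ℕ) :
    chi n = if n % 2 = 0 then 0 else if n % 4 = 1 then 1 else -1 := by
  rw [chi, ZMod.χ₄_nat_eq_if_mod_four]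
  split_ifs <;> simp

lemma chi_mul (m n : ℕ) : chi (m * n) = chi m * chi n := by
  rw [chi, chi, chi, Nat.cast_mul, map_mul, Int.cast_mul]

lemma abs_chi_le_one (n : ℕ) : |chi n| ≤ 1 := by
  rw [chi_eq]
  split_ifs <;> simp

lemma sum_chi (N : ℕ) :
    ∑ n ∈ Finset.Ioc 0 N, chi n = if N % 4 = 1 ∨ N % 4 = 2 then 1 else 0 := by
  induction N with
  | zero => simp
  | succ N ih =>
    rw [Finset.sum_Ioc_succ_top (Nat.zero_le N), ih, chi_eq]
    have h : N % 4 < 4 := Nat.mod_lt _ (by norm_num)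
    split_ifs <;> first | omega | norm_num

lemma sum_Ioc_sub (f : ℕ → ℝ) {M N : ℕ} (h : M ≤ N) :
    ∑ n ∈ Finset.Ioc M N, f n = ∑ n ∈ Finset.Ioc 0 N, f n - ∑ n ∈ Finset.Ioc 0 M, f n := by
  rw [← Finset.sum_Ioc_consecutive f (Nat.zero_le M) h]
  ring

lemma abs_sum_chi_le_one {M N : ℕ} (h : M ≤ N) : |∑ n ∈ Finset.Ioc M N, chi n| ≤ 1 := by
  rw [sum_Ioc_sub chi h, sum_chi, sum_chi]
  split_ifs <;> simp

/-- Abel summation bound for sums of the character against a decreasing weight. -/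
lemma abs_sum_chi_mul_le (g : ℕ → ℝ) (M N : ℕ) (h0 : ∀ n, 0 ≤ g n)
    (hg : ∀ n, M < n → g (n + 1) ≤ g n) :
    |∑ n ∈ Finset.Ioc M N, chi n * g n| ≤ g (M + 1) := by
  rcases le_or_gt M N with h | h
  swap
  · rw [Finset.Ioc_eq_empty (by omega)]
    simpa using h0 _
  have key : |∑ n ∈ Finset.Ioc M N, chi n * g n - (∑ n ∈ Finset.Ioc M N, chi n) * g (N + 1)|
      ≤ g (M + 1) - g (N + 1) := by
    induction N, h using Nat.le_induction with
    | base => simp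
    | succ N hN ih =>
      have hB := abs_sum_chi_le_one (show M ≤ N + 1 by omega)
      rw [Finset.sum_Ioc_succ_top hN] at hB ⊢
      rw [Finset.sum_Ioc_succ_top hN]
      set B := ∑ n ∈ Finset.Ioc M N, chi n
      set S := ∑ n ∈ Finset.Ioc M N, chi n * g n
      have hd := hg (N + 1) (by omega)
      have e : S + chi (N + 1) * g (N + 1) - (B + chi (N + 1)) * g (N + 1 + 1)
          = (S - B * g (N + 1)) + (B + chi (N + 1)) * (g (N + 1) - g (N + 1 + 1)) := by ring
      rw [e]
      have h2 : |(B + chi (N + 1)) * (g (N + 1) - g (N + 1 + 1))| ≤ g (N + 1) - g (N + 1 + 1) := by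
        rw [abs_mul, abs_of_nonneg (sub_nonneg.2 hd)]
        exact mul_le_of_le_one_left (sub_nonneg.2 hd) hB
      linarith [abs_add_le (S - B * g (N + 1)) ((B + chi (N + 1)) * (g (N + 1) - g (N + 1 + 1)))]
  have hB := abs_sum_chi_le_one h
  set B := ∑ n ∈ Finset.Ioc M N, chi n
  have h2 : |B * g (N + 1)| ≤ g (N + 1) := by
    rw [abs_mul, abs_of_nonneg (h0 _)]
    exact mul_le_of_le_one_left (h0 _) hB
  have h3 := abs_add_le (∑ n ∈ Finset.Ioc M N, chi n * g n - B * g (N + 1)) (B * g (N + 1))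
  rw [sub_add_cancel] at h3
  linarith

/-- Summation of a Dirichlet convolution. -/
lemma sum_convolution (f g : ℕ → ℝ) (N : ℕ) :
    ∑ n ∈ Finset.Ioc 0 N, ∑ x ∈ n.divisorsAntidiagonal, f x.1 * g x.2 =
      ∑ n ∈ Finset.Ioc 0 N, f n * ∑ m ∈ Finset.Ioc 0 (N / n), g m := by
  have h := ArithmeticFunction.sum_Ioc_mul_eq_sum_sum
    (⟨fun n => if n = 0 then 0 else f n, by simp⟩ : ArithmeticFunction ℝ)
    ⟨fun n => if n = 0 then 0 else g n, by simp⟩ N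
  have e1 : ∀ n ∈ Finset.Ioc 0 N, ∀ h : ℕ → ℝ, (if n = 0 then 0 else h n) = h n := by
    intro n hn h
    rw [if_neg (by simp at hn; omega)]
  simp only [ArithmeticFunction.coe_mk] at h
  convert h using 1
  · refine Finset.sum_congr rfl fun n hn => Finset.sum_congr rfl fun x hx => ?_
    have := Nat.mem_divisorsAntidiagonal.1 hx
    have h1 : x.1 ≠ 0 := by rintro h; simp [h] at this; omega
    have h2 : x.2 ≠ 0 := by rintro h; simp [h] at this; omega
    simp [h1, h2]
  · refine Finset.sum_congr rfl fun n hn => ?_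
    rw [e1 n hn]
    congr 1
    refine Finset.sum_congr rfl fun m hm => ?_
    rw [if_neg (by simp at hm; omega)]

open ArithmeticFunction in
lemma sum_antidiagonal_vonMangoldt (n : ℕ) :
    ∑ x ∈ n.divisorsAntidiagonal, vonMangoldt x.1 = Real.log n := by
  rw [Nat.sum_divisorsAntidiagonal (f := fun i _ => vonMangoldt i)]
  exact vonMangoldt_sum

open ArithmeticFunction in
lemma sum_vonMangoldt_le (N : ℕ) : ∑ n ∈ Finset.Ioc 0 N, vonMangoldt n ≤ 6 * N := by
  have h := Chebyshev.psi_le_const_mul_self (x := N) (by positivity)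
  rw [Chebyshev.psi, Nat.floor_natCast] at h
  have h4 : Real.log 4 ≤ 2 := by
    rw [show (4 : ℝ) = 2 ^ 2 by norm_num, Real.log_pow]
    have := Real.log_two_lt_d9
    push_cast
    linarith
  nlinarith [(Nat.cast_nonneg N : (0 : ℝ) ≤ N)]

lemma sum_log_le (N : ℕ) : ∑ n ∈ Finset.Ioc 0 N, Real.log n ≤ N * Real.log N := by
  calc ∑ n ∈ Finset.Ioc 0 N, Real.log n ≤ ∑ n ∈ Finset.Ioc 0 N, Real.log N := by
        refine Finset.sum_le_sum fun n hn => ?_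
        rw [Finset.mem_Ioc] at hn
        exact Real.log_le_log (by exact_mod_cast hn.1) (by exact_mod_cast hn.2)
    _ = _ := by simp

lemma le_sum_log (N : ℕ) : N * Real.log N - N ≤ ∑ n ∈ Finset.Ioc 0 N, Real.log n := by
  induction N with
  | zero => simp
  | succ N ih =>
    rw [Finset.sum_Ioc_succ_top (Nat.zero_le N)]
    rcases Nat.eq_zero_or_pos N with rfl | hN
    · simp
    have hN' : (0 : ℝ) < N := by exact_mod_cast hN
    have h := Real.log_le_sub_one_of_pos (show (0 : ℝ) < (N + 1) / N by positivity)
    rw [Real.log_div (by positivity) (by positivity)] at h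
    have h2 : (N : ℝ) * (Real.log (N + 1) - Real.log N) ≤ 1 := by
      calc (N : ℝ) * (Real.log (N + 1) - Real.log N) ≤ N * ((N + 1) / N - 1) := by gcongr
        _ = 1 := by field_simp; ring
    push_cast
    nlinarith

open ArithmeticFunction in
/-- Mertens' first theorem. -/
lemma abs_sum_vonMangoldt_div_sub_log_le {N : ℕ} (hN : 1 ≤ N) :
    |∑ n ∈ Finset.Ioc 0 N, vonMangoldt n / n - Real.log N| ≤ 6 := by
  have hN' : (0 : ℝ) < N := by exact_mod_cast hN
  have h := sum_convolution (fun n => vonMangoldt n) (fun _ => 1) N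
  simp only [mul_one, sum_antidiagonal_vonMangoldt] at h
  have h1 := sum_log_le N
  have h2 := le_sum_log N
  have h3 := sum_vonMangoldt_le N
  rw [h] at h1 h2
  have e : ∀ n : ℕ, ∑ m ∈ Finset.Ioc 0 (N / n), (1 : ℝ) = ((N / n : ℕ) : ℝ) := by simp
  simp only [e] at h1 h2
  have u : ∑ n ∈ Finset.Ioc 0 N, vonMangoldt n * ((N / n : ℕ) : ℝ)
      ≤ N * ∑ n ∈ Finset.Ioc 0 N, vonMangoldt n / n := by
    rw [Finset.mul_sum]
    refine Finset.sum_le_sum fun n hn => ?_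
    have : ((N / n : ℕ) : ℝ) ≤ N / n := Nat.cast_div_le
    calc vonMangoldt n * ((N / n : ℕ) : ℝ) ≤ vonMangoldt n * (N / n) := by gcongr
      _ = _ := by ring
  have l : N * ∑ n ∈ Finset.Ioc 0 N, vonMangoldt n / n - ∑ n ∈ Finset.Ioc 0 N, vonMangoldt n
      ≤ ∑ n ∈ Finset.Ioc 0 N, vonMangoldt n * ((N / n : ℕ) : ℝ) := by
    rw [Finset.mul_sum, ← Finset.sum_sub_distrib]
    refine Finset.sum_le_sum fun n hn => ?_
    have : (N : ℝ) / n - 1 ≤ ((N / n : ℕ) : ℝ) := by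
      rw [← Nat.floor_div_eq_div (K := ℝ)]
      linarith [Nat.lt_floor_add_one ((N : ℝ) / n)]
    calc _ = vonMangoldt n * ((N : ℝ) / n - 1) := by ring
      _ ≤ _ := by gcongr
  set S := ∑ n ∈ Finset.Ioc 0 N, vonMangoldt n / n
  rw [abs_le]
  constructor
  · have : N * (Real.log N - 1) ≤ N * S := by linarith
    have := le_of_mul_le_mul_left this hN'
    linarith
  · have : N * S ≤ N * (Real.log N + 6) := by linarith
    have := le_of_mul_le_mul_left this hN'
    linarith

lemma abs_sum_chi_log_div_le (N : ℕ) :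
    |∑ n ∈ Finset.Ioc 0 N, chi n * (Real.log n / n)| ≤ 1 := by
  rcases lt_or_ge N 2 with h | h
  · interval_cases N <;> simp
  rw [← Finset.sum_Ioc_consecutive _ (Nat.zero_le 2) h]
  have e : ∑ n ∈ Finset.Ioc 0 2, chi n * (Real.log n / n) = 0 := by
    rw [show Finset.Ioc 0 2 = {1, 2} by rfl, Finset.sum_pair (by norm_num)]
    simp [chi_eq 2]
  rw [e, zero_add]
  refine (abs_sum_chi_mul_le (fun n => Real.log n / n) 2 N (fun n => ?_) fun n hn => ?_).trans ?_
  · exact div_nonneg (Real.log_natCast_nonneg n) (Nat.cast_nonneg n)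
  · have h3 : Real.exp 1 ≤ n := by
      have h4 : (3 : ℝ) ≤ n := by exact_mod_cast hn
      linarith [Real.exp_one_lt_d9]
    exact Real.log_div_self_antitoneOn h3 (by simp; linarith) (by simp)
  · have := Real.log_le_sub_one_of_pos (show (0 : ℝ) < 3 by norm_num)
    norm_num
    linarith

lemma abs_sum_chi_div_le (M N : ℕ) :
    |∑ n ∈ Finset.Ioc M N, chi n / n| ≤ 1 / (M + 1) := by
  have h := abs_sum_chi_mul_le (fun n => 1 / (n : ℝ)) M N (fun n => by positivity) fun n hn => by
    have : (0 : ℝ) < n := by exact_mod_cast (by omega : 0 < n)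
    push_cast
    gcongr
    linarith
  simpa [div_eq_mul_inv] using h

lemma half_le_sum_chi_div {N : ℕ} (hN : 1 ≤ N) :
    1 / 2 ≤ ∑ n ∈ Finset.Ioc 0 N, chi n / n := by
  rw [← Finset.sum_Ioc_consecutive _ (Nat.zero_le 1) hN]
  have := abs_le.1 (abs_sum_chi_div_le 1 N)
  norm_num at this
  have h1 : chi 1 = 1 := by simp [chi_eq]
  simp [h1]
  linarith

open ArithmeticFunction in
lemma abs_sum_chi_vonMangoldt_div_le {N : ℕ} (hN : 1 ≤ N) :
    |∑ n ∈ Finset.Ioc 0 N, chi n * vonMangoldt n / n| ≤ 14 := by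
  have hN' : (0 : ℝ) < N := by exact_mod_cast hN
  have h := sum_convolution (fun n => chi n * vonMangoldt n / n) (fun n => chi n / n) N
  have e : ∀ n ∈ Finset.Ioc 0 N, ∑ x ∈ n.divisorsAntidiagonal,
      chi x.1 * vonMangoldt x.1 / x.1 * (chi x.2 / x.2) = chi n * (Real.log n / n) := by
    intro n hn
    rw [← sum_antidiagonal_vonMangoldt, Finset.sum_div, Finset.mul_sum]
    refine Finset.sum_congr rfl fun x hx => ?_
    have := (Nat.mem_divisorsAntidiagonal.1 hx).1
    rw [← this, chi_mul]
    push_cast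
    ring
  rw [Finset.sum_congr rfl e] at h
  have h1 := abs_sum_chi_log_div_le N
  rw [h] at h1
  set L := ∑ n ∈ Finset.Ioc 0 N, chi n / n with hL
  have hL2 : 1 / 2 ≤ L := half_le_sum_chi_div hN
  set S := ∑ n ∈ Finset.Ioc 0 N, chi n * vonMangoldt n / n with hS
  have h2 : |S * L - ∑ n ∈ Finset.Ioc 0 N, chi n * vonMangoldt n / n *
      ∑ m ∈ Finset.Ioc 0 (N / n), chi m / m| ≤ 6 := by
    rw [hS, Finset.sum_mul, ← Finset.sum_sub_distrib]
    refine (Finset.abs_sum_le_sum_abs _ _).trans ?_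
    calc _ ≤ ∑ n ∈ Finset.Ioc 0 N, vonMangoldt n / N := by
          refine Finset.sum_le_sum fun n hn => ?_
          rw [Finset.mem_Ioc] at hn
          have hn' : (0 : ℝ) < n := by exact_mod_cast hn.1
          rw [← mul_sub, hL, ← sum_Ioc_sub _ (Nat.div_le_self N n), abs_mul, abs_div, abs_mul,
            abs_of_pos hn', abs_of_nonneg (vonMangoldt_nonneg (n := n))]
          have q1 : |∑ m ∈ Finset.Ioc (N / n) N, chi m / m| ≤ n / N := by
            refine (abs_sum_chi_div_le _ _).trans ?_
            rw [div_le_div_iff₀ (by positivity) hN', one_mul]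
            have := Nat.lt_floor_add_one ((N : ℝ) / n)
            rw [Nat.floor_div_eq_div, div_lt_iff₀ hn'] at this
            linarith
          calc _ ≤ 1 * vonMangoldt n / n * (n / N) := by
                gcongr
                exact abs_chi_le_one n
            _ = _ := by field_simp
      _ ≤ 6 := by
          rw [← Finset.sum_div, div_le_iff₀ hN']
          exact sum_vonMangoldt_le N
  have h3 : |S * L| ≤ 7 := by
    have := abs_add_le (S * L - ∑ n ∈ Finset.Ioc 0 N, chi n * vonMangoldt n / n *
      ∑ m ∈ Finset.Ioc 0 (N / n), chi m / m) (∑ n ∈ Finset.Ioc 0 N, chi n * vonMangoldt n / n *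
      ∑ m ∈ Finset.Ioc 0 (N / n), chi m / m)
    rw [sub_add_cancel] at this
    linarith
  rw [abs_mul, abs_of_nonneg (by linarith : 0 ≤ L)] at h3
  nlinarith [abs_nonneg S]

/-- The von Mangoldt function weighted to be supported on prime powers that are sums of
two squares. -/
noncomputable def lam (n : ℕ) : ℝ := ArithmeticFunction.vonMangoldt n * (1 + chi n) / 2

lemma lam_nonneg (n : ℕ) : 0 ≤ lam n := by
  have := abs_le.1 (abs_chi_le_one n)
  have h := ArithmeticFunction.vonMangoldt_nonneg (n := n)
  unfold lam
  have : 0 ≤ 1 + chi n := by linarith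
  positivity

lemma lam_le (n : ℕ) : lam n ≤ ArithmeticFunction.vonMangoldt n := by
  have := abs_le.1 (abs_chi_le_one n)
  have h := ArithmeticFunction.vonMangoldt_nonneg (n := n)
  unfold lam
  nlinarith

lemma abs_sum_lam_div_sub_le {N : ℕ} (hN : 1 ≤ N) :
    |∑ n ∈ Finset.Ioc 0 N, lam n / n - Real.log N / 2| ≤ 10 := by
  have h1 := abs_le.1 (abs_sum_vonMangoldt_div_sub_log_le hN)
  have h2 := abs_le.1 (abs_sum_chi_vonMangoldt_div_le hN)
  have e : ∑ n ∈ Finset.Ioc 0 N, lam n / n =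
      (∑ n ∈ Finset.Ioc 0 N, ArithmeticFunction.vonMangoldt n / n +
        ∑ n ∈ Finset.Ioc 0 N, chi n * ArithmeticFunction.vonMangoldt n / n) / 2 := by
    rw [← Finset.sum_add_distrib, Finset.sum_div]
    refine Finset.sum_congr rfl fun n _ => ?_
    unfold lam
    ring
  rw [e, abs_le]
  constructor <;> linarith

/-- Chebyshev-type lower bound for prime powers that are sums of two squares. -/
lemma exists_le_sum_lam :
    ∃ c : ℝ, 0 < c ∧ ∀ N : ℕ, 2 ≤ N → c * N ≤ ∑ n ∈ Finset.Ioc 0 N, lam n := by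
  refine ⟨1 / (4 * 2 ^ 64), by positivity, fun N hN => ?_⟩
  have hN' : (0 : ℝ) < N := by exact_mod_cast (by omega : 0 < N)
  rcases lt_or_ge N (2 ^ 64) with h | h
  · have h1 : lam 2 ≤ ∑ n ∈ Finset.Ioc 0 N, lam n :=
      Finset.single_le_sum (f := lam) (fun n _ => lam_nonneg n) (by simp; omega)
    have h2 : lam 2 = Real.log 2 / 2 := by
      simp [lam, chi_eq, ArithmeticFunction.vonMangoldt_apply_prime Nat.prime_two]
    have h3 := Real.log_two_gt_d9
    have h4 : (N : ℝ) ≤ 2 ^ 64 := by exact_mod_cast h.le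
    have : 1 / (4 * 2 ^ 64) * (N : ℝ) ≤ 1 / (4 * 2 ^ 64) * 2 ^ 64 := by gcongr
    norm_num at this ⊢
    linarith
  · set M := N / 2 ^ 64 with hM
    have hM1 : 1 ≤ M := by omega
    have hMN : M ≤ N := Nat.div_le_self _ _
    have hM' : (0 : ℝ) < M := by exact_mod_cast hM1
    have h1 := abs_le.1 (abs_sum_lam_div_sub_le hM1)
    have h2 := abs_le.1 (abs_sum_lam_div_sub_le (hM1.trans hMN))
    have h3 : 64 * Real.log 2 ≤ Real.log N - Real.log M := by
      rw [← Real.log_div (by positivity) (by positivity)]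
      have : (64 : ℝ) * Real.log 2 = Real.log (2 ^ 64) := by rw [Real.log_pow]; norm_num
      rw [this]
      refine Real.log_le_log (by positivity) ?_
      rw [le_div_iff₀ hM']
      exact_mod_cast (Nat.mul_div_le N (2 ^ 64))
    have h4 := Real.log_two_gt_d9
    have h5 : 1 ≤ ∑ n ∈ Finset.Ioc M N, lam n / n := by
      rw [sum_Ioc_sub _ hMN]
      linarith
    have h6 : ∑ n ∈ Finset.Ioc M N, lam n / n ≤ ∑ n ∈ Finset.Ioc M N, lam n * (2 ^ 64 / N) := by
      refine Finset.sum_le_sum fun n hn => ?_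
      rw [Finset.mem_Ioc] at hn
      have hn' : (0 : ℝ) < n := by exact_mod_cast (by omega : 0 < n)
      rw [div_eq_mul_inv]
      refine mul_le_mul_of_nonneg_left ?_ (lam_nonneg n)
      rw [inv_eq_one_div, div_le_div_iff₀ hn' hN', one_mul]
      exact_mod_cast (by omega : N ≤ 2 ^ 64 * n)
    rw [← Finset.sum_mul] at h6
    have h7 : ∑ n ∈ Finset.Ioc M N, lam n ≤ ∑ n ∈ Finset.Ioc 0 N, lam n := by
      rw [sum_Ioc_sub _ hMN]
      linarith [Finset.sum_nonneg (s := Finset.Ioc 0 M) fun n _ => lam_nonneg n]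
    have h8 : 1 ≤ (∑ n ∈ Finset.Ioc M N, lam n) * (2 ^ 64 / N) := h5.trans h6
    rw [mul_div_assoc', le_div_iff₀ hN'] at h8
    rw [div_mul_eq_mul_div, div_le_iff₀ (by positivity)]
    nlinarith

lemma isSumTwoSquares_iff (n : ℕ) : IsSumTwoSquares n ↔ ∃ x y : ℕ, n = x ^ 2 + y ^ 2 := by
  constructor
  · rintro ⟨x, y, h⟩
    refine ⟨x.natAbs, y.natAbs, ?_⟩
    zify
    simpa using h
  · rintro ⟨x, y, h⟩
    exact ⟨x, y, by exact_mod_cast h⟩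

lemma IsSumTwoSquares.mul {m n : ℕ} (hm : IsSumTwoSquares m) (hn : IsSumTwoSquares n) :
    IsSumTwoSquares (m * n) := by
  rw [isSumTwoSquares_iff] at *
  obtain ⟨x, y, h⟩ := hm
  obtain ⟨u, v, h'⟩ := hn
  obtain ⟨r, s, hrs⟩ := Nat.sq_add_sq_mul h h'
  exact ⟨r, s, hrs⟩

lemma isSumTwoSquares_of_lam_ne_zero {q : ℕ} (h : lam q ≠ 0) : IsSumTwoSquares q := by
  have h1 : ArithmeticFunction.vonMangoldt q ≠ 0 := by
    intro h0
    simp [lam, h0] at h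
  have h2 : chi q ≠ -1 := by
    intro h0
    simp [lam, h0] at h
  obtain ⟨p, k, hp, hk, rfl⟩ := ArithmeticFunction.vonMangoldt_ne_zero_iff.1 h1
  replace hp := hp.nat_prime
  have := Fact.mk hp
  rw [isSumTwoSquares_iff, Nat.eq_sq_add_sq_iff]
  intro r hr hr3
  rw [Nat.primeFactors_prime_pow hk.ne' hp, Finset.mem_singleton] at hr
  subst hr
  rw [padicValNat.prime_pow]
  by_contra hodd
  apply h2
  have : ∀ j, chi (r ^ j) = chi r ^ j := by
    intro j
    induction j with
    | zero => simp [chi_eq]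
    | succ j ih => rw [pow_succ, chi_mul, ih, pow_succ]
  rw [this, chi_eq r, if_neg (by omega), if_neg (by omega)]
  exact (Nat.not_even_iff_odd.1 hodd).neg_one_pow

lemma b_mul_lam_le (m q : ℕ) : (b m : ℝ) * lam q ≤ b (m * q) * ArithmeticFunction.vonMangoldt q := by
  have h0 := ArithmeticFunction.vonMangoldt_nonneg (n := q)
  by_cases h : lam q = 0
  · rw [h, mul_zero]
    positivity
  by_cases hm : IsSumTwoSquares m
  · have := hm.mul (isSumTwoSquares_of_lam_ne_zero h)
    simpa [b, hm, this] using lam_le q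
  · simp only [b, hm, if_false]
    rw [Nat.cast_zero, zero_mul]
    positivity

lemma sum_antidiagonal_b_mul_lam_le (n : ℕ) :
    ∑ x ∈ n.divisorsAntidiagonal, (b x.1 : ℝ) * lam x.2 ≤ b n * Real.log n := by
  have h : ∑ x ∈ n.divisorsAntidiagonal, ArithmeticFunction.vonMangoldt x.2 = Real.log n := by
    rw [Nat.sum_divisorsAntidiagonal' (f := fun _ i => ArithmeticFunction.vonMangoldt i)]
    exact ArithmeticFunction.vonMangoldt_sum
  rw [← h, Finset.mul_sum]
  refine Finset.sum_le_sum fun x hx => ?_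
  rw [← (Nat.mem_divisorsAntidiagonal.1 hx).1]
  exact b_mul_lam_le _ _

/-- The sum of reciprocals of the positive sums of two squares up to `N`. -/
noncomputable def recipSum (N : ℕ) : ℝ := ∑ n ∈ Finset.Ioc 0 N, (b n : ℝ) / n

lemma recipSum_mono {M N : ℕ} (h : M ≤ N) : recipSum M ≤ recipSum N := by
  have := sum_Ioc_sub (fun n => (b n : ℝ) / n) h
  have h2 : 0 ≤ ∑ n ∈ Finset.Ioc M N, (b n : ℝ) / n := Finset.sum_nonneg fun _ _ => by positivity
  unfold recipSum
  linarith

lemma recipSum_one : recipSum 1 = 1 := by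
  have : IsSumTwoSquares 1 := ⟨1, 0, by norm_num⟩
  simp [recipSum, b, this]

lemma half_div_le_nat_div {m N : ℕ} (hm : 0 < m) (h : m ≤ N) :
    (N : ℝ) / m / 2 ≤ ((N / m : ℕ) : ℝ) := by
  have h1 : 1 ≤ N / m := (Nat.one_le_div_iff hm).2 h
  have h2 := Nat.lt_floor_add_one ((N : ℝ) / m)
  rw [Nat.floor_div_eq_div] at h2
  have h3 : (1 : ℝ) ≤ ((N / m : ℕ) : ℝ) := by exact_mod_cast h1
  linarith

/-- The logarithmically averaged form of the recursion for sums of two squares. -/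
lemma sum_log_ratio_le {N : ℕ} (hN : 1 ≤ N) :
    ∑ m ∈ Finset.Ioc 0 N, (b m : ℝ) / m * (Real.log N - Real.log m) ≤
      (2 / 3 * Real.log N + 8) * recipSum N := by
  have hN' : (0 : ℝ) < N := by exact_mod_cast hN
  have h := sum_convolution (fun n => (b n : ℝ) / n) (fun n => lam n / n) N
  have h1 : ∑ n ∈ Finset.Ioc 0 N, ∑ x ∈ n.divisorsAntidiagonal,
      (b x.1 : ℝ) / x.1 * (lam x.2 / x.2) ≤ ∑ n ∈ Finset.Ioc 0 N, (b n : ℝ) / n * Real.log n := by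
    refine Finset.sum_le_sum fun n hn => ?_
    calc _ = (∑ x ∈ n.divisorsAntidiagonal, (b x.1 : ℝ) * lam x.2) / n := by
          rw [Finset.sum_div]
          refine Finset.sum_congr rfl fun x hx => ?_
          rw [← (Nat.mem_divisorsAntidiagonal.1 hx).1]
          push_cast
          rw [div_mul_div_comm]
      _ ≤ (b n * Real.log n) / n := by gcongr; exact sum_antidiagonal_b_mul_lam_le n
      _ = _ := by ring
  rw [h] at h1
  have h2 : ∑ m ∈ Finset.Ioc 0 N, (b m : ℝ) / m * ((Real.log N - Real.log m) / 2 - 11) ≤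
      ∑ m ∈ Finset.Ioc 0 N, (b m : ℝ) / m * ∑ n ∈ Finset.Ioc 0 (N / m), lam n / n := by
    refine Finset.sum_le_sum fun m hm => mul_le_mul_of_nonneg_left ?_ (by positivity)
    rw [Finset.mem_Ioc] at hm
    have hm' : (0 : ℝ) < m := by exact_mod_cast hm.1
    have h3 : 1 ≤ N / m := (Nat.one_le_div_iff hm.1).2 hm.2
    have h4 := abs_le.1 (abs_sum_lam_div_sub_le h3)
    have h5 := Real.log_le_log (by positivity) (half_div_le_nat_div hm.1 hm.2)
    rw [Real.log_div (by positivity) (by positivity),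
      Real.log_div (by positivity) (by positivity)] at h5
    have := Real.log_two_lt_d9
    linarith
  have e1 : ∑ m ∈ Finset.Ioc 0 N, (b m : ℝ) / m * ((Real.log N - Real.log m) / 2 - 11) =
      (∑ m ∈ Finset.Ioc 0 N, (b m : ℝ) / m * (Real.log N - Real.log m)) / 2
        - 11 * recipSum N := by
    rw [recipSum, Finset.sum_div, Finset.mul_sum, ← Finset.sum_sub_distrib]
    exact Finset.sum_congr rfl fun _ _ => by ring
  have e2 : ∑ m ∈ Finset.Ioc 0 N, (b m : ℝ) / m * (Real.log N - Real.log m) =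
      Real.log N * recipSum N - ∑ n ∈ Finset.Ioc 0 N, (b n : ℝ) / n * Real.log n := by
    rw [recipSum, Finset.mul_sum, ← Finset.sum_sub_distrib]
    exact Finset.sum_congr rfl fun _ _ => by ring
  have h0 : 0 ≤ recipSum N := Finset.sum_nonneg fun _ _ => by positivity
  nlinarith

lemma log_two_mul_sum_recipSum_le (k : ℕ) :
    Real.log 2 * ∑ j ∈ Finset.range k, recipSum (2 ^ j) ≤
      ∑ m ∈ Finset.Ioc 0 (2 ^ k), (b m : ℝ) / m * (Real.log (2 ^ k : ℕ) - Real.log m) := by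
  induction k with
  | zero => simp [show Finset.Ioc 0 1 = {1} from rfl]
  | succ k ih =>
    rw [Finset.sum_range_succ, mul_add]
    have hk : 2 ^ k ≤ 2 ^ (k + 1) := Nat.pow_le_pow_right (by norm_num) (by omega)
    rw [← Finset.sum_Ioc_consecutive _ (Nat.zero_le (2 ^ k)) hk]
    have h1 : 0 ≤ ∑ m ∈ Finset.Ioc (2 ^ k) (2 ^ (k + 1)),
        (b m : ℝ) / m * (Real.log (2 ^ (k + 1) : ℕ) - Real.log m) := by
      refine Finset.sum_nonneg fun m hm => mul_nonneg (by positivity) (sub_nonneg.2 ?_)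
      rw [Finset.mem_Ioc] at hm
      refine Real.log_le_log ?_ (by exact_mod_cast hm.2)
      exact_mod_cast (Nat.zero_le _).trans_lt hm.1
    have h2 : ∑ m ∈ Finset.Ioc 0 (2 ^ k),
        (b m : ℝ) / m * (Real.log (2 ^ (k + 1) : ℕ) - Real.log m) =
        ∑ m ∈ Finset.Ioc 0 (2 ^ k), (b m : ℝ) / m * (Real.log (2 ^ k : ℕ) - Real.log m)
          + Real.log 2 * recipSum (2 ^ k) := by
      rw [recipSum, Finset.mul_sum, ← Finset.sum_add_distrib]
      refine Finset.sum_congr rfl fun m _ => ?_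
      push_cast
      rw [Real.log_pow, Real.log_pow]
      push_cast
      ring
    rw [h2]
    linarith

lemma sum_recipSum_le (k : ℕ) :
    ∑ j ∈ Finset.range k, recipSum (2 ^ j) ≤ (2 / 3 * k + 12) * recipSum (2 ^ k) := by
  have h1 := log_two_mul_sum_recipSum_le k
  have h2 := sum_log_ratio_le (N := 2 ^ k) Nat.one_le_two_pow
  have h3 := h1.trans h2
  push_cast at h3
  rw [Real.log_pow] at h3
  have h4 := Real.log_two_gt_d9
  have h0 : 0 ≤ recipSum (2 ^ k) := Finset.sum_nonneg fun _ _ => by positivity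
  have h5 : Real.log 2 * ∑ j ∈ Finset.range k, recipSum (2 ^ j) ≤
      Real.log 2 * ((2 / 3 * k + 12) * recipSum (2 ^ k)) := by
    refine h3.trans ?_
    have : (2 / 3 * (k * Real.log 2) + 8) ≤ Real.log 2 * (2 / 3 * k + 12) := by nlinarith
    calc _ ≤ (Real.log 2 * (2 / 3 * k + 12)) * recipSum (2 ^ k) := by gcongr
      _ = _ := by ring
  exact le_of_mul_le_mul_left h5 (by linarith)

lemma exists_le_recipSum_two_pow :
    ∃ c : ℝ, 0 < c ∧ ∀ k : ℕ, c * ((k : ℝ) + 1) ^ ((1 : ℝ) / 4) ≤ recipSum (2 ^ k) := by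
  set c : ℝ := ((19 : ℝ) ^ ((5 : ℝ) / 4))⁻¹ with hc
  have hc0 : 0 < c := by positivity
  have hP : ∀ k : ℕ, c * ((k : ℝ) + 1 + 18) ^ ((5 : ℝ) / 4) ≤
      ∑ j ∈ Finset.range (k + 1), recipSum (2 ^ j) := by
    intro k
    induction k with
    | zero =>
      simp only [zero_add, Finset.range_one, Finset.sum_singleton, pow_zero, recipSum_one,
        Nat.cast_zero]
      norm_num [hc]
    | succ k ih =>
      rw [Finset.sum_range_succ]
      have h1 := sum_recipSum_le (k + 1)
      set P := ∑ j ∈ Finset.range (k + 1), recipSum (2 ^ j)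
      set f := recipSum (2 ^ (k + 1))
      push_cast at h1 ⊢
      set y : ℝ := (k : ℝ) + 1 + 18 with hy
      have hy19 : 19 ≤ y := by
        have : (0 : ℝ) ≤ k := Nat.cast_nonneg k
        linarith
      have hy0 : 0 < y := by linarith
      have e1 : (k : ℝ) + 1 + 1 + 18 = y * (1 + 1 / y) := by field_simp; rw [hy]; ring
      rw [e1, Real.mul_rpow hy0.le (by positivity)]
      have e2 : (1 + 1 / y) ^ ((5 : ℝ) / 4) ≤ 1 + 3 / 2 / y := by
        rw [show (5 : ℝ) / 4 = 1 + 1 / 4 by norm_num, Real.rpow_add (by positivity), Real.rpow_one]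
        have hb := rpow_one_add_le_one_add_mul_self (s := 1 / y) (p := 1 / 4)
          (by have : 0 < 1 / y := by positivity
              linarith) (by norm_num) (by norm_num)
        have ht : 0 < 1 / y := by positivity
        have ht1 : 1 / y ≤ 1 := by rw [div_le_one hy0]; linarith
        calc _ ≤ (1 + 1 / y) * (1 + 1 / 4 * (1 / y)) := by gcongr
          _ ≤ 1 + 3 / 2 * (1 / y) := by nlinarith
          _ = _ := by ring
      have h2 : P * (3 / 2 / y) ≤ f := by
        rw [mul_div_assoc', div_le_iff₀ hy0]
        rw [hy]
        linarith
      have hP0 : 0 ≤ y ^ ((5 : ℝ) / 4) := by positivity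
      calc c * (y ^ ((5 : ℝ) / 4) * (1 + 1 / y) ^ ((5 : ℝ) / 4))
          ≤ c * (y ^ ((5 : ℝ) / 4) * (1 + 3 / 2 / y)) := by gcongr
        _ = (c * y ^ ((5 : ℝ) / 4)) * (1 + 3 / 2 / y) := by ring
        _ ≤ P * (1 + 3 / 2 / y) := by gcongr
        _ ≤ P + f := by linarith
  refine ⟨c, hc0, fun k => ?_⟩
  rcases k with _ | k
  · have : c ≤ 1 := inv_le_one_of_one_le₀ (Real.one_le_rpow (by norm_num) (by norm_num))
    simpa [recipSum_one] using this
  have h1 := sum_recipSum_le (k + 1)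
  have h2 := hP k
  push_cast at h1 ⊢
  set y : ℝ := (k : ℝ) + 1 + 18 with hy
  have hy0 : 0 < y := by positivity
  have h3 : c * y ^ ((1 : ℝ) / 4) * y ≤ recipSum (2 ^ (k + 1)) * y := by
    have : y ^ ((5 : ℝ) / 4) = y ^ ((1 : ℝ) / 4) * y := by
      rw [show (5 : ℝ) / 4 = 1 / 4 + 1 by norm_num, Real.rpow_add hy0, Real.rpow_one]
    rw [this, ← mul_assoc] at h2
    have h4 := h2.trans h1
    have h0 : 0 ≤ recipSum (2 ^ (k + 1)) := Finset.sum_nonneg fun _ _ => by positivity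
    rw [hy] at h4 ⊢
    nlinarith
  refine le_trans ?_ (le_of_mul_le_mul_right h3 hy0)
  gcongr
  rw [hy]
  linarith

/-- A lower bound for the number of sums of two squares up to `N`. -/
lemma exists_le_sum_b :
    ∃ c : ℝ, 0 < c ∧ ∀ N : ℕ, 2 ≤ N →
      c * (N * Real.log N ^ ((1 : ℝ) / 4)) ≤ (∑ n ∈ Finset.Ioc 0 N, (b n : ℝ)) * Real.log N := by
  obtain ⟨c₁, hc₁, h₁⟩ := exists_le_sum_lam
  obtain ⟨c₂, hc₂, h₂⟩ := exists_le_recipSum_two_pow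
  refine ⟨c₁ / 2 * (c₂ * (1 / 2) ^ ((1 : ℝ) / 4)), by positivity, fun N hN => ?_⟩
  have hN' : (0 : ℝ) < N := by exact_mod_cast (by omega : 0 < N)
  have h3 : ∑ n ∈ Finset.Ioc 0 N, (b n : ℝ) * Real.log n ≤
      (∑ n ∈ Finset.Ioc 0 N, (b n : ℝ)) * Real.log N := by
    rw [Finset.sum_mul]
    refine Finset.sum_le_sum fun n hn => mul_le_mul_of_nonneg_left ?_ (by positivity)
    rw [Finset.mem_Ioc] at hn
    exact Real.log_le_log (by exact_mod_cast hn.1) (by exact_mod_cast hn.2)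
  have h4 : ∑ n ∈ Finset.Ioc 0 N, (b n : ℝ) * ∑ m ∈ Finset.Ioc 0 (N / n), lam m ≤
      ∑ n ∈ Finset.Ioc 0 N, (b n : ℝ) * Real.log n := by
    rw [← sum_convolution (fun n => (b n : ℝ)) lam N]
    exact Finset.sum_le_sum fun n _ => sum_antidiagonal_b_mul_lam_le n
  have h5 : ∑ n ∈ Finset.Ioc 0 (N / 2), (b n : ℝ) * ∑ m ∈ Finset.Ioc 0 (N / n), lam m ≤
      ∑ n ∈ Finset.Ioc 0 N, (b n : ℝ) * ∑ m ∈ Finset.Ioc 0 (N / n), lam m := by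
    refine Finset.sum_le_sum_of_subset_of_nonneg
      (Finset.Ioc_subset_Ioc_right (Nat.div_le_self _ _)) fun n _ _ => ?_
    exact mul_nonneg (by positivity) (Finset.sum_nonneg fun m _ => lam_nonneg m)
  have h6 : c₁ / 2 * N * recipSum (N / 2) ≤
      ∑ n ∈ Finset.Ioc 0 (N / 2), (b n : ℝ) * ∑ m ∈ Finset.Ioc 0 (N / n), lam m := by
    rw [recipSum, Finset.mul_sum]
    refine Finset.sum_le_sum fun n hn => ?_
    rw [Finset.mem_Ioc] at hn
    have hn2 : 2 ≤ N / n := by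
      rw [Nat.le_div_iff_mul_le hn.1]
      omega
    calc _ = (b n : ℝ) * (c₁ * ((N : ℝ) / n / 2)) := by ring
      _ ≤ (b n : ℝ) * (c₁ * ((N / n : ℕ) : ℝ)) := by
        gcongr
        exact half_div_le_nat_div hn.1 (by omega)
      _ ≤ _ := by
        gcongr
        exact h₁ _ hn2
  have h7 : c₂ * (1 / 2) ^ ((1 : ℝ) / 4) * Real.log N ^ ((1 : ℝ) / 4) ≤ recipSum (N / 2) := by
    have hL : 1 ≤ Nat.log 2 N := Nat.log_pos (by norm_num) hN
    obtain ⟨k, hk⟩ : ∃ k, Nat.log 2 N = k + 1 := ⟨Nat.log 2 N - 1, by omega⟩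
    have hk1 : 2 ^ (k + 1) ≤ N := hk ▸ Nat.pow_log_le_self 2 (by omega)
    have hk2 : N < 2 ^ (k + 1 + 1) := hk ▸ Nat.lt_pow_succ_log_self (by norm_num) N
    have h8 : 2 ^ k ≤ N / 2 := by
      rw [Nat.le_div_iff_mul_le (by norm_num), ← pow_succ]
      exact hk1
    refine le_trans ?_ ((h₂ k).trans (recipSum_mono h8))
    rw [mul_assoc, ← Real.mul_rpow (by norm_num) (Real.log_natCast_nonneg N)]
    gcongr
    have h9 : Real.log N ≤ (k + 1 + 1) * Real.log 2 := by
      have := Real.log_le_log hN' (show (N : ℝ) ≤ 2 ^ (k + 1 + 1) by exact_mod_cast hk2.le)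
      rw [Real.log_pow] at this
      exact_mod_cast this
    have := Real.log_two_lt_d9
    have hk0 : (0 : ℝ) ≤ k := Nat.cast_nonneg k
    nlinarith
  calc _ = c₁ / 2 * N * (c₂ * (1 / 2) ^ ((1 : ℝ) / 4) * Real.log N ^ ((1 : ℝ) / 4)) := by ring
    _ ≤ c₁ / 2 * N * recipSum (N / 2) := by gcongr
    _ ≤ _ := h6.trans (h5.trans (h4.trans h3))

/-- A second moment lower bound for the measure of a finite union. -/
lemma second_moment_le_measureReal_biUnion {ι : Type*} (P : Finset ι) (I : ι → Set ℝ)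
    (hm : ∀ i, MeasurableSet (I i)) (hf : ∀ i, volume (I i) ≠ ⊤) (t : ℝ) :
    2 * t * ∑ i ∈ P, volume.real (I i)
      - t ^ 2 * ∑ i ∈ P, ∑ k ∈ P, volume.real (I i ∩ I k) ≤ volume.real (⋃ i ∈ P, I i) := by
  have hi : ∀ s : Set ℝ, MeasurableSet s → volume s ≠ ⊤ →
      Integrable (s.indicator (fun _ => (1 : ℝ))) := fun s hs hs' =>
    (integrable_indicator_iff hs).2 (integrableOn_const hs')
  have hii : ∀ i k, volume (I i ∩ I k) ≠ ⊤ := fun i k =>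
    measure_ne_top_of_subset Set.inter_subset_left (hf i)
  have hU : volume (⋃ i ∈ P, I i) ≠ ⊤ :=
    ((measure_biUnion_finset_le P I).trans_lt
      (ENNReal.sum_lt_top.2 fun i _ => (hf i).lt_top)).ne
  have hUm : MeasurableSet (⋃ i ∈ P, I i) := Finset.measurableSet_biUnion P fun i _ => hm i
  have e1 : ∑ i ∈ P, volume.real (I i) =
      ∫ x, ∑ i ∈ P, (I i).indicator (fun _ => (1 : ℝ)) x := by
    rw [integral_finsetSum _ fun i _ => hi _ (hm i) (hf i)]
    exact Finset.sum_congr rfl fun i _ => by simp [integral_indicator (hm i)]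
  have e2 : ∑ i ∈ P, ∑ k ∈ P, volume.real (I i ∩ I k) =
      ∫ x, ∑ i ∈ P, ∑ k ∈ P, (I i ∩ I k).indicator (fun _ => (1 : ℝ)) x := by
    rw [integral_finsetSum _ fun i _ => integrable_finsetSum _ fun k _ =>
      hi _ ((hm i).inter (hm k)) (hii i k)]
    refine Finset.sum_congr rfl fun i _ => ?_
    rw [integral_finsetSum _ fun k _ => hi _ ((hm i).inter (hm k)) (hii i k)]
    exact Finset.sum_congr rfl fun k _ => by simp [integral_indicator ((hm i).inter (hm k))]
  have e3 : volume.real (⋃ i ∈ P, I i) =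
      ∫ x, (⋃ i ∈ P, I i).indicator (fun _ => (1 : ℝ)) x := by
    simp [integral_indicator hUm]
  have g1 : Integrable (fun x => ∑ i ∈ P, (I i).indicator (fun _ => (1 : ℝ)) x) :=
    integrable_finsetSum _ fun i _ => hi _ (hm i) (hf i)
  have g2 : Integrable
      (fun x => ∑ i ∈ P, ∑ k ∈ P, (I i ∩ I k).indicator (fun _ => (1 : ℝ)) x) :=
    integrable_finsetSum _ fun i _ => integrable_finsetSum _ fun k _ =>
      hi _ ((hm i).inter (hm k)) (hii i k)
  rw [e1, e2, e3, ← integral_const_mul, ← integral_const_mul,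
    ← integral_sub (g1.const_mul _) (g2.const_mul _)]
  refine integral_mono ((g1.const_mul _).sub (g2.const_mul _)) (hi _ hUm hU) fun x => ?_
  have h4 : ∑ i ∈ P, ∑ k ∈ P, (I i ∩ I k).indicator (fun _ => (1 : ℝ)) x =
      (∑ i ∈ P, (I i).indicator (fun _ => (1 : ℝ)) x) ^ 2 := by
    rw [sq, Finset.sum_mul_sum]
    refine Finset.sum_congr rfl fun i _ => Finset.sum_congr rfl fun k _ => ?_
    by_cases h1 : x ∈ I i <;> by_cases h2 : x ∈ I k <;> simp [h1, h2]
  simp only [h4]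
  by_cases hx : x ∈ ⋃ i ∈ P, I i
  · rw [Set.indicator_of_mem hx]
    nlinarith [sq_nonneg (1 - t * ∑ i ∈ P, (I i).indicator (fun _ => (1 : ℝ)) x)]
  · rw [Set.indicator_of_notMem hx]
    have : ∑ i ∈ P, (I i).indicator (fun _ => (1 : ℝ)) x = 0 := by
      refine Finset.sum_eq_zero fun i hiP => Set.indicator_of_notMem (fun h => hx ?_) _
      exact Set.mem_biUnion hiP h
    simp [this]

/-- The number of pairs of distinct fractions `a / q`, `b / r` at bounded distance. -/
lemma card_close_fractions_le {q r : ℕ} (hq : 0 < q) (X : ℝ) (hX : 0 ≤ X) :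
    ((((Finset.range q ×ˢ Finset.range r).filter fun p =>
      p.1 * r ≠ p.2 * q ∧ |(p.1 : ℝ) * r - p.2 * q| < X).card : ℕ) : ℝ) ≤ 2 * X := by
  set d := Nat.gcd q r with hd
  have hd0 : 0 < d := Nat.gcd_pos_of_pos_left _ hq
  obtain ⟨q', r', hcop, hq', hr'⟩ := Nat.exists_coprime q r
  rw [← hd] at hq' hr'
  have hq'0 : 0 < q' := by
    rcases Nat.eq_zero_or_pos q' with h | h
    · simp [h] at hq'; omega
    · exact h
  have hdR : (0 : ℝ) < d := by exact_mod_cast hd0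
  set K : ℕ := ⌊X / d⌋₊ with hK
  have hcard : ((Finset.range q ×ˢ Finset.range r).filter fun p =>
      p.1 * r ≠ p.2 * q ∧ |(p.1 : ℝ) * r - p.2 * q| < X).card ≤
      (((Finset.Icc (-(K : ℤ)) K).erase 0) ×ˢ Finset.range d).card := by
    refine Finset.card_le_card_of_injOn
      (fun p => (((p.1 : ℤ) * r' - p.2 * q'), p.1 / q')) ?_ ?_
    · rintro ⟨x, y⟩ hp
      simp only [Finset.coe_filter, Finset.mem_product, Finset.mem_range, Set.mem_ofPred_eq] at hp
      obtain ⟨⟨hx, hy⟩, hne, hlt⟩ := hp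
      simp only [Finset.coe_product, Set.mem_prod, Finset.mem_coe, Finset.mem_erase,
        Finset.mem_Icc, Finset.mem_range]
      refine ⟨⟨?_, ?_⟩, ?_⟩
      · intro h0
        apply hne
        have : (x : ℤ) * r = y * q := by
          rw [hq', hr']
          push_cast
          linear_combination (d : ℤ) * h0
        exact_mod_cast this
      · rw [← abs_le]
        have h1 : |((x : ℝ) * r' - y * q')| < X / d := by
          rw [lt_div_iff₀ hdR]
          have e : (x : ℝ) * r - y * q = (x * r' - y * q') * d := by
            rw [hq', hr']
            push_cast
            ring
          rwa [e, abs_mul, abs_of_pos hdR] at hlt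
        have h2 : ((|(x : ℤ) * r' - y * q'|.toNat : ℕ) : ℝ) ≤ X / d := by
          have : (((|(x : ℤ) * r' - y * q'|).toNat : ℤ) : ℝ) = |((x : ℝ) * r' - y * q')| := by
            rw [Int.toNat_of_nonneg (abs_nonneg _)]
            push_cast
            rfl
          rw [← Int.cast_natCast, this]
          exact h1.le
        have h3 := Nat.le_floor h2
        rw [← hK] at h3
        omega
      · rw [Nat.div_lt_iff_lt_mul hq'0, mul_comm, mul_comm]
        rw [hq'] at hx
        linarith
    · rintro ⟨x, y⟩ hp ⟨x', y'⟩ hp' h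
      simp only [Prod.mk.injEq] at h
      obtain ⟨h1, h2⟩ := h
      have h3 : ((x : ℤ) - x') * r' = (y - y') * q' := by linear_combination h1
      have h4 : (q' : ℤ) ∣ (x : ℤ) - x' := by
        have hc : IsCoprime (q' : ℤ) (r' : ℤ) := Nat.isCoprime_iff_coprime.2 hcop
        have hd : (q' : ℤ) ∣ ((x : ℤ) - x') * r' := ⟨(y : ℤ) - y', by rw [h3]; ring⟩
        exact hc.dvd_of_dvd_mul_right hd
      have h5 : x' ≡ x [MOD q'] := (Nat.modEq_iff_dvd).2 h4
      have h6 : x = x' := by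
        rw [← Nat.div_add_mod x q', ← Nat.div_add_mod x' q', h2, h5]
      subst h6
      have h7 : ((y : ℤ) - y') = 0 := by
        have : ((y : ℤ) - y') * q' = 0 := by rw [← h3]; ring
        rcases mul_eq_zero.1 this with h | h
        · exact h
        · have : q' = 0 := by exact_mod_cast h
          omega
      have : y = y' := by omega
      rw [this]
  have hc2 : (((Finset.Icc (-(K : ℤ)) K).erase 0) ×ˢ Finset.range d).card = 2 * K * d := by
    rw [Finset.card_product, Finset.card_range, Finset.card_erase_of_mem (by simp), Int.card_Icc]
    congr 1
    omega
  rw [hc2] at hcard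
  have hK2 : (K : ℝ) ≤ X / d := Nat.floor_le (by positivity)
  calc _ ≤ ((2 * K * d : ℕ) : ℝ) := by exact_mod_cast hcard
    _ = 2 * K * d := by push_cast; ring
    _ ≤ 2 * (X / d) * d := by gcongr
    _ = 2 * X := by field_simp

/-- Radii of approximation, comparable to `1 / (q ^ 2 * log q)`. -/
noncomputable def rad (q : ℕ) : ℝ := 1 / (16 ^ (Nat.log 4 q + 1) * ((Nat.log 4 q : ℝ) + 1))

lemma rad_pos (q : ℕ) : 0 < rad q := by
  unfold rad
  positivity

/-- The open interval around `a / q` attached to the pair `(q, a)`. -/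
noncomputable def nbhd (p : ℕ × ℕ) : Set ℝ := Metric.ball ((p.2 : ℝ) / p.1) (rad p.1)

lemma measureReal_nbhd (p : ℕ × ℕ) : volume.real (nbhd p) = 2 * rad p.1 := by
  rw [nbhd, measureReal_def, Real.volume_ball, ENNReal.toReal_ofReal]
  have := rad_pos p.1
  positivity

/-- Reduced fractions with denominator in `B`. -/
noncomputable def fracs (B : Finset ℕ) : Finset (ℕ × ℕ) :=
  B.biUnion fun q => ((Finset.range q).filter (Nat.Coprime q)).image fun x => (q, x)

lemma mem_fracs {B : Finset ℕ} {p : ℕ × ℕ} :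
    p ∈ fracs B ↔ p.1 ∈ B ∧ p.2 < p.1 ∧ Nat.Coprime p.1 p.2 := by
  rcases p with ⟨q, x⟩
  simp only [fracs, Finset.mem_biUnion, Finset.mem_image, Finset.mem_filter, Finset.mem_range,
    Prod.mk.injEq]
  constructor
  · rintro ⟨q', hq', x', hx', rfl, rfl⟩
    exact ⟨hq', hx'⟩
  · rintro ⟨h1, h2⟩
    exact ⟨q, h1, x, h2, rfl, rfl⟩

lemma sum_fracs (B : Finset ℕ) (f : ℕ × ℕ → ℝ) :
    ∑ p ∈ fracs B, f p =
      ∑ q ∈ B, ∑ x ∈ (Finset.range q).filter (Nat.Coprime q), f (q, x) := by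
  rw [fracs, Finset.sum_biUnion]
  · refine Finset.sum_congr rfl fun q _ => ?_
    rw [Finset.sum_image]
    intro x _ y _ h
    exact (Prod.mk.inj h).2
  · intro q _ r _ hqr
    rw [Function.onFun, Finset.disjoint_left]
    intro p hp hp'
    simp only [Finset.mem_image] at hp hp'
    obtain ⟨x, _, rfl⟩ := hp
    obtain ⟨y, _, h⟩ := hp'
    exact hqr (Prod.mk.inj h).1.symm

lemma sum_measureReal_nbhd (B : Finset ℕ) :
    ∑ p ∈ fracs B, volume.real (nbhd p) = ∑ q ∈ B, 2 * (Nat.totient q * rad q) := by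
  rw [sum_fracs]
  refine Finset.sum_congr rfl fun q _ => ?_
  simp only [measureReal_nbhd, Finset.sum_const, nsmul_eq_mul, Nat.totient]
  ring

lemma eq_of_reduced {q r x y : ℕ} (hq : 0 < q) (h1 : Nat.Coprime q x) (h2 : Nat.Coprime r y)
    (h : x * r = y * q) : q = r ∧ x = y := by
  have e1 : q ∣ r := h1.dvd_of_dvd_mul_left ⟨y, by rw [h]; ring⟩
  have e2 : r ∣ q := h2.dvd_of_dvd_mul_left ⟨x, by rw [← h]; ring⟩
  have e := Nat.dvd_antisymm e1 e2
  subst e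
  exact ⟨rfl, Nat.eq_of_mul_eq_mul_right hq h⟩

lemma measureReal_nbhd_inter_le (p p' : ℕ × ℕ) :
    volume.real (nbhd p ∩ nbhd p') ≤ 2 * min (rad p.1) (rad p'.1) := by
  have h1 : volume.real (nbhd p ∩ nbhd p') ≤ volume.real (nbhd p) :=
    measureReal_mono Set.inter_subset_left measure_ball_lt_top.ne
  have h2 : volume.real (nbhd p ∩ nbhd p') ≤ volume.real (nbhd p') :=
    measureReal_mono Set.inter_subset_right measure_ball_lt_top.ne
  rw [measureReal_nbhd] at h1 h2
  rw [mul_min_of_nonneg _ _ (by norm_num)]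
  exact le_min h1 h2

lemma abs_lt_of_nbhd_inter {q r x y : ℕ} (hq : 0 < q) (hr : 0 < r)
    (h : (nbhd (q, x) ∩ nbhd (r, y)).Nonempty) :
    |(x : ℝ) * r - y * q| < q * r * (rad q + rad r) := by
  obtain ⟨z, hz1, hz2⟩ := h
  simp only [nbhd, Metric.mem_ball, Real.dist_eq] at hz1 hz2
  have hq' : (0 : ℝ) < q := by exact_mod_cast hq
  have hr' : (0 : ℝ) < r := by exact_mod_cast hr
  have e : (x : ℝ) * r - y * q = q * r * ((z - y / r) - (z - x / q)) := by
    field_simp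
    ring
  rw [e, abs_mul, abs_of_pos (by positivity : (0 : ℝ) < q * r)]
  gcongr
  linarith [abs_sub (z - (y : ℝ) / r) (z - x / q)]

/-- Total overlap of the intervals attached to distinct reduced fractions of denominators
`q` and `r`. -/
lemma sum_overlap_le {q r : ℕ} (hq : 0 < q) (hr : 0 < r) :
    ∑ x ∈ (Finset.range q).filter (Nat.Coprime q), ∑ y ∈ (Finset.range r).filter (Nat.Coprime r),
      (if (q, x) = (r, y) then 0 else volume.real (nbhd (q, x) ∩ nbhd (r, y))) ≤
      8 * ((q * rad q) * (r * rad r)) := by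
  have h1 := rad_pos q
  have h2 := rad_pos r
  have hX : 0 ≤ (q : ℝ) * r * (rad q + rad r) := by positivity
  rw [← Finset.sum_product']
  have hc := card_close_fractions_le (q := q) (r := r) hq _ hX
  set F := (Finset.range q ×ˢ Finset.range r).filter fun p =>
      p.1 * r ≠ p.2 * q ∧ |(p.1 : ℝ) * r - p.2 * q| < q * r * (rad q + rad r) with hF
  calc _ ≤ ∑ p ∈ (Finset.range q).filter (Nat.Coprime q) ×ˢ
          (Finset.range r).filter (Nat.Coprime r),
          (if p ∈ F then 2 * min (rad q) (rad r) else 0) := by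
        refine Finset.sum_le_sum fun p hp => ?_
        simp only [Finset.mem_product, Finset.mem_filter, Finset.mem_range] at hp
        obtain ⟨⟨hx, hxc⟩, ⟨hy, hyc⟩⟩ := hp
        split_ifs with he hm hm
        · positivity
        · exact le_rfl
        · exact measureReal_nbhd_inter_le _ _
        · refine le_of_eq ?_
          have hempty : nbhd (q, p.1) ∩ nbhd (r, p.2) = ∅ := by
            by_contra hne
            apply hm
            simp only [hF, Finset.mem_filter, Finset.mem_product, Finset.mem_range]
            refine ⟨⟨hx, hy⟩, fun heq => he ?_,
              abs_lt_of_nbhd_inter hq hr (Set.nonempty_iff_ne_empty.2 hne)⟩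
            obtain ⟨e1, e2⟩ := eq_of_reduced hq hxc hyc heq
            rw [e1, e2]
          simp [hempty]
    _ ≤ ∑ p ∈ F, 2 * min (rad q) (rad r) := by
        rw [← Finset.sum_filter]
        refine Finset.sum_le_sum_of_subset_of_nonneg ?_ fun _ _ _ => by positivity
        intro p hp
        exact (Finset.mem_filter.1 hp).2
    _ = (F.card : ℝ) * (2 * min (rad q) (rad r)) := by
        rw [Finset.sum_const, nsmul_eq_mul]
    _ ≤ (2 * (q * r * (rad q + rad r))) * (2 * min (rad q) (rad r)) := by gcongr
    _ = 4 * (q * r) * ((rad q + rad r) * min (rad q) (rad r)) := by ring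
    _ ≤ 4 * (q * r) * (2 * (rad q * rad r)) := by
        have hm : (rad q + rad r) * min (rad q) (rad r) ≤ 2 * (rad q * rad r) := by
          rcases le_total (rad q) (rad r) with h | h
          · rw [min_eq_left h]; nlinarith
          · rw [min_eq_right h]; nlinarith
        exact mul_le_mul_of_nonneg_left hm (by positivity)
    _ = _ := by ring

lemma sum_sum_measureReal_inter_le (B : Finset ℕ) (hB : ∀ q ∈ B, 0 < q) :
    ∑ p ∈ fracs B, ∑ p' ∈ fracs B, volume.real (nbhd p ∩ nbhd p') ≤
      ∑ p ∈ fracs B, volume.real (nbhd p) + 8 * (∑ q ∈ B, (q : ℝ) * rad q) ^ 2 := by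
  have h1 : ∀ p ∈ fracs B, ∑ p' ∈ fracs B, volume.real (nbhd p ∩ nbhd p') =
      volume.real (nbhd p) +
        ∑ p' ∈ fracs B, (if p = p' then 0 else volume.real (nbhd p ∩ nbhd p')) := by
    intro p hp
    have : volume.real (nbhd p) = ∑ p' ∈ fracs B, (if p = p' then volume.real (nbhd p) else 0) := by
      rw [Finset.sum_ite_eq, if_pos hp]
    rw [this, ← Finset.sum_add_distrib]
    refine Finset.sum_congr rfl fun p' _ => ?_
    split_ifs with h
    · subst h; simp
    · simp
  rw [Finset.sum_congr rfl h1, Finset.sum_add_distrib]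
  gcongr
  rw [sum_fracs, sq, Finset.sum_mul_sum, Finset.mul_sum]
  refine Finset.sum_le_sum fun q hq => ?_
  rw [Finset.mul_sum]
  simp only [sum_fracs]
  rw [Finset.sum_comm]
  exact Finset.sum_le_sum fun r hr => sum_overlap_le (hB q hq) (hB r hr)

lemma half_le_sum_totient_div (N : ℕ) :
    (N : ℝ) / 2 ≤ ∑ n ∈ Finset.Ioc 0 N, (Nat.totient n : ℝ) / n := by
  rcases Nat.eq_zero_or_pos N with rfl | hN
  · simp
  have hN' : (0 : ℝ) < N := by exact_mod_cast hN
  have h := sum_convolution (fun n => (Nat.totient n : ℝ)) (fun _ => 1) N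
  have e : ∀ n ∈ Finset.Ioc 0 N, ∑ x ∈ n.divisorsAntidiagonal, (Nat.totient x.1 : ℝ) * 1 = n := by
    intro n _
    simp only [mul_one]
    rw [Nat.sum_divisorsAntidiagonal (f := fun i _ => (Nat.totient i : ℝ))]
    exact_mod_cast Nat.sum_totient n
  rw [Finset.sum_congr rfl e] at h
  have h2 : ∑ n ∈ Finset.Ioc 0 N, (n : ℝ) = N * (N + 1) / 2 := by
    clear hN hN' h e
    induction N with
    | zero => simp
    | succ N ih =>
      rw [Finset.sum_Ioc_succ_top (Nat.zero_le N), ih]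
      push_cast
      ring
  have h3 : ∑ n ∈ Finset.Ioc 0 N, (Nat.totient n : ℝ) * ∑ m ∈ Finset.Ioc 0 (N / n), (1 : ℝ) ≤
      N * ∑ n ∈ Finset.Ioc 0 N, (Nat.totient n : ℝ) / n := by
    rw [Finset.mul_sum]
    refine Finset.sum_le_sum fun n _ => ?_
    have : ((N / n : ℕ) : ℝ) ≤ N / n := Nat.cast_div_le
    calc _ = (Nat.totient n : ℝ) * ((N / n : ℕ) : ℝ) := by simp
      _ ≤ (Nat.totient n : ℝ) * (N / n) := by gcongr
      _ = _ := by ring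
  rw [h2] at h
  refine le_of_mul_le_mul_left (le_trans ?_ h3) hN'
  rw [← h]
  nlinarith

lemma log_four_eq {j q : ℕ} (h : q ∈ Finset.Ico (4 ^ j) (4 ^ (j + 1))) : Nat.log 4 q = j := by
  rw [Finset.mem_Ico] at h
  exact Nat.log_eq_of_pow_le_of_lt_pow h.1 h.2

lemma sum_mul_rad_block_le (j : ℕ) :
    ∑ q ∈ Finset.Ico ((4 : ℕ) ^ j) (4 ^ (j + 1)), (q : ℝ) * rad q ≤ 3 / 4 * (1 / ((j : ℝ) + 1)) := by
  calc _ ≤ ∑ q ∈ Finset.Ico ((4 : ℕ) ^ j) (4 ^ (j + 1)),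
        (4 : ℝ) ^ (j + 1) * (1 / (16 ^ (j + 1) * ((j : ℝ) + 1))) := by
        refine Finset.sum_le_sum fun q hq => ?_
        rw [rad, log_four_eq hq]
        rw [Finset.mem_Ico] at hq
        gcongr
        exact_mod_cast hq.2.le
    _ = 3 / 4 * (1 / ((j : ℝ) + 1)) := by
        rw [Finset.sum_const, Nat.card_Ico, nsmul_eq_mul]
        have : (4 : ℕ) ^ (j + 1) - 4 ^ j = 3 * 4 ^ j := by rw [pow_succ]; omega
        rw [this, show (16 : ℝ) = 4 * 4 by norm_num, mul_pow]
        push_cast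
        field_simp
        ring

lemma le_sum_totient_rad_block (j : ℕ) :
    1 / 8 * (1 / ((j : ℝ) + 1)) ≤
      ∑ q ∈ Finset.Ico (4 ^ j) (4 ^ (j + 1)), 2 * (Nat.totient q * rad q) := by
  have hp : 1 ≤ 4 ^ j := Nat.one_le_pow _ _ (by norm_num)
  have hs : (4 : ℕ) ^ (j + 1) = 4 * 4 ^ j := by rw [pow_succ]; ring
  have hI : Finset.Ico (4 ^ j) (4 ^ (j + 1)) = Finset.Ioc (4 ^ j - 1) (4 ^ (j + 1) - 1) := by
    ext x
    simp only [Finset.mem_Ico, Finset.mem_Ioc]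
    omega
  have h1 : (4 : ℝ) ^ j ≤
      ∑ q ∈ Finset.Ico (4 ^ j) (4 ^ (j + 1)), (Nat.totient q : ℝ) / q := by
    rw [hI, sum_Ioc_sub _ (by omega)]
    have h2 := half_le_sum_totient_div (4 ^ (j + 1) - 1)
    have h3 : ∑ n ∈ Finset.Ioc 0 (4 ^ j - 1), (Nat.totient n : ℝ) / n ≤ ((4 ^ j - 1 : ℕ) : ℝ) := by
      calc _ ≤ ∑ n ∈ Finset.Ioc 0 (4 ^ j - 1), (1 : ℝ) := by
            refine Finset.sum_le_sum fun n _ => div_le_one_of_le₀ ?_ (by positivity)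
            exact_mod_cast Nat.totient_le n
        _ = _ := by simp
    rw [Nat.cast_sub (by omega)] at h2
    rw [Nat.cast_sub hp] at h3
    push_cast at h2 h3
    have : (4 : ℝ) ^ (j + 1) = 4 * 4 ^ j := by rw [pow_succ]; ring
    rw [this] at h2
    linarith
  calc 1 / 8 * (1 / ((j : ℝ) + 1))
      = 2 * 4 ^ j * (1 / (16 ^ (j + 1) * ((j : ℝ) + 1))) * 4 ^ j := by
        rw [show (16 : ℝ) = 4 * 4 by norm_num, mul_pow]
        field_simp
        ring
    _ ≤ 2 * 4 ^ j * (1 / (16 ^ (j + 1) * ((j : ℝ) + 1))) *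
        ∑ q ∈ Finset.Ico (4 ^ j) (4 ^ (j + 1)), (Nat.totient q : ℝ) / q := by gcongr
    _ ≤ _ := by
        rw [Finset.mul_sum]
        refine Finset.sum_le_sum fun q hq => ?_
        rw [rad, log_four_eq hq]
        rw [Finset.mem_Ico] at hq
        have hq0 : (0 : ℝ) < q := by exact_mod_cast (by omega : 0 < q)
        have h4 : (4 : ℝ) ^ j ≤ q := by exact_mod_cast hq.1
        calc _ = 2 * ((Nat.totient q : ℝ) * (1 / (16 ^ (j + 1) * ((j : ℝ) + 1)))) *
              (4 ^ j / q) := by ring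
          _ ≤ 2 * ((Nat.totient q : ℝ) * (1 / (16 ^ (j + 1) * ((j : ℝ) + 1)))) * 1 := by
              gcongr
              exact div_le_one_of_le₀ h4 hq0.le
          _ = _ := by ring

lemma sum_Ico_four_pow (f : ℕ → ℝ) {J J' : ℕ} (h : J ≤ J') :
    ∑ q ∈ Finset.Ico (4 ^ J) (4 ^ J'), f q =
      ∑ j ∈ Finset.Ico J J', ∑ q ∈ Finset.Ico (4 ^ j) (4 ^ (j + 1)), f q := by
  induction J', h using Nat.le_induction with
  | base => simp
  | succ k hk ih =>
    rw [Finset.sum_Ico_succ_top hk, ← ih, Finset.sum_Ico_consecutive]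
    · exact Nat.pow_le_pow_right (by norm_num) hk
    · exact Nat.pow_le_pow_right (by norm_num) (by omega)

lemma exists_le_measureReal_nbhds (J : ℕ) :
    ∃ J', (1 : ℝ) / 289 ≤ volume.real (⋃ p ∈ fracs (Finset.Ico (4 ^ J) (4 ^ J')), nbhd p) := by
  have hdiv : ∃ J', J ≤ J' ∧ 8 ≤ ∑ j ∈ Finset.Ico J J', 1 / ((j : ℝ) + 1) := by
    have ht := Real.tendsto_sum_range_one_div_nat_succ_atTop
    obtain ⟨n, hn⟩ := (ht.eventually_ge_atTop
      (8 + ∑ i ∈ Finset.range J, 1 / ((i : ℝ) + 1))).and (eventually_ge_atTop J) |>.exists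
    refine ⟨n, hn.2, ?_⟩
    rw [Finset.sum_Ico_eq_sub _ hn.2]
    linarith [hn.1]
  obtain ⟨J', hJ, h8⟩ := hdiv
  refine ⟨J', ?_⟩
  set B := Finset.Ico (4 ^ J) (4 ^ J') with hB
  have hB0 : ∀ q ∈ B, 0 < q := fun q hq => by
    rw [hB, Finset.mem_Ico] at hq
    exact (Nat.pow_pos (by norm_num)).trans_le hq.1
  set H := ∑ j ∈ Finset.Ico J J', 1 / ((j : ℝ) + 1) with hH
  set s := ∑ p ∈ fracs B, volume.real (nbhd p) with hs
  set u := ∑ q ∈ B, (q : ℝ) * rad q with hu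
  have hs1 : 1 / 8 * H ≤ s := by
    rw [hs, sum_measureReal_nbhd, hB, sum_Ico_four_pow _ hJ, hH, Finset.mul_sum]
    exact Finset.sum_le_sum fun j _ => le_sum_totient_rad_block j
  have hu1 : u ≤ 3 / 4 * H := by
    rw [hu, hB, sum_Ico_four_pow _ hJ, hH, Finset.mul_sum]
    exact Finset.sum_le_sum fun j _ => sum_mul_rad_block_le j
  have hu0 : 0 ≤ u := Finset.sum_nonneg fun q _ => mul_nonneg (by positivity) (rad_pos q).le
  have hmain := second_moment_le_measureReal_biUnion (fracs B) nbhd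
    (fun p => Metric.isOpen_ball.measurableSet) (fun p => measure_ball_lt_top.ne) (1 / (289 * s))
  have h2 := sum_sum_measureReal_inter_le B hB0
  rw [← hs] at hmain h2
  rw [← hu] at h2
  refine le_trans ?_ hmain
  have hs2 : 1 ≤ s := by linarith
  have hus : u ≤ 6 * s := by linarith
  have hE : ∑ p ∈ fracs B, ∑ p' ∈ fracs B, volume.real (nbhd p ∩ nbhd p') ≤ 289 * s ^ 2 := by
    have : u ^ 2 ≤ (6 * s) ^ 2 := by gcongr
    nlinarith
  have hs0 : 0 < s := by linarith
  calc (1 : ℝ) / 289 = 2 * (1 / (289 * s)) * s - (1 / (289 * s)) ^ 2 * (289 * s ^ 2) := by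
        field_simp
        norm_num
    _ ≤ _ := by gcongr

lemma rad_mul_sq_le {q : ℕ} (hq : 0 < q) : rad q * q ^ 2 * ((Nat.log 4 q : ℝ) + 1) ≤ 1 := by
  have h : (q : ℝ) < 4 ^ (Nat.log 4 q + 1) := by
    exact_mod_cast Nat.lt_pow_succ_log_self (by norm_num) q
  have h2 : (q : ℝ) ^ 2 ≤ 16 ^ (Nat.log 4 q + 1) := by
    rw [show (16 : ℝ) = 4 ^ 2 by norm_num, ← pow_mul, mul_comm 2, pow_mul]
    gcongr
  rw [rad]
  calc _ = (q : ℝ) ^ 2 / 16 ^ (Nat.log 4 q + 1) := by field_simp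
    _ ≤ 1 := div_le_one_of_le₀ h2 (by positivity)

lemma nbhd_subset {p : ℕ × ℕ} (h2 : 2 ≤ p.1) (hlt : p.2 < p.1) (hc : Nat.Coprime p.1 p.2) :
    nbhd p ⊆ Set.Ioo 0 1 := by
  obtain ⟨q, x⟩ := p
  simp only at h2 hlt hc
  have hx : 1 ≤ x := by
    rcases Nat.eq_zero_or_pos x with rfl | h
    · simp at hc; omega
    · exact h
  have hq : (2 : ℝ) ≤ q := by exact_mod_cast h2
  have hx' : (1 : ℝ) ≤ x := by exact_mod_cast hx
  have hxq : (x : ℝ) + 1 ≤ q := by exact_mod_cast hlt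
  have h0 := rad_pos q
  have hr : rad q * q ≤ 1 := by
    have h := rad_mul_sq_le (q := q) (by omega)
    have hj : (0 : ℝ) ≤ Nat.log 4 q := Nat.cast_nonneg _
    have hA : rad q * q ≤ rad q * q ^ 2 := by
      rw [sq]
      gcongr
      nlinarith
    have hB : rad q * q ^ 2 ≤ rad q * q ^ 2 * ((Nat.log 4 q : ℝ) + 1) :=
      le_mul_of_one_le_right (by positivity) (by linarith)
    linarith
  have hr2 : rad q ≤ 1 / q := by rwa [le_div_iff₀ (by linarith)]
  intro z hz
  rw [nbhd, Metric.mem_ball, Real.dist_eq, abs_lt] at hz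
  have e1 : 1 / (q : ℝ) ≤ x / q := by gcongr
  have e2 : (x : ℝ) / q + 1 / q ≤ 1 := by
    rw [← add_div]
    exact div_le_one_of_le₀ hxq (by linarith)
  simp only at hz
  constructor <;> linarith [hz.1, hz.2]

lemma tendsto_rad : Tendsto rad atTop (nhds 0) := by
  refine squeeze_zero' (Eventually.of_forall fun q => (rad_pos q).le) ?_
    tendsto_inv_atTop_nhds_zero_nat
  filter_upwards [eventually_ge_atTop 1] with q hq
  have hq' : (1 : ℝ) ≤ q := by exact_mod_cast hq
  have h := rad_mul_sq_le (q := q) hq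
  have hj : (0 : ℝ) ≤ Nat.log 4 q := Nat.cast_nonneg _
  have h0 := rad_pos q
  have hA : rad q * q ≤ rad q * q ^ 2 := by
    rw [sq]
    gcongr
    nlinarith
  have hB : rad q * q ^ 2 ≤ rad q * q ^ 2 * ((Nat.log 4 q : ℝ) + 1) :=
    le_mul_of_one_le_right (by positivity) (by linarith)
  rw [← one_div, le_div_iff₀ (by linarith)]
  linarith

lemma volume_limsup_nbhd_pos :
    0 < volume (⋂ J : ℕ, ⋃ p ∈ {p : ℕ × ℕ | 4 ^ (J + 1) ≤ p.1 ∧ p.2 < p.1 ∧ Nat.Coprime p.1 p.2},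
      nbhd p) := by
  set E : ℕ → Set ℝ := fun J =>
    ⋃ p ∈ {p : ℕ × ℕ | 4 ^ (J + 1) ≤ p.1 ∧ p.2 < p.1 ∧ Nat.Coprime p.1 p.2}, nbhd p with hE
  have hsub : ∀ J, E J ⊆ Set.Ioo 0 1 := by
    intro J
    refine Set.iUnion₂_subset fun p hp => nbhd_subset ?_ hp.2.1 hp.2.2
    have : 4 ^ 1 ≤ 4 ^ (J + 1) := Nat.pow_le_pow_right (by norm_num) (by omega)
    exact le_trans (by omega) hp.1
  have hfin : ∀ J, volume (E J) ≠ ⊤ := fun J =>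
    measure_ne_top_of_subset (hsub J) (by simp)
  have hanti : Antitone E := by
    intro J J' h
    refine Set.biUnion_subset_biUnion_left fun p hp => ⟨le_trans ?_ hp.1, hp.2⟩
    exact Nat.pow_le_pow_right (by norm_num) (by omega)
  have hmeas : ∀ J, NullMeasurableSet (E J) volume := fun J =>
    (isOpen_biUnion fun p _ => Metric.isOpen_ball).measurableSet.nullMeasurableSet
  have ht := tendsto_measure_iInter_atTop (μ := volume) hmeas hanti ⟨0, hfin 0⟩
  have hge : ∀ J, ENNReal.ofReal (1 / 289) ≤ volume (E J) := by
    intro J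
    obtain ⟨J', hJ'⟩ := exists_le_measureReal_nbhds (J + 1)
    rw [ENNReal.ofReal_le_iff_le_toReal (hfin J)]
    refine hJ'.trans (measureReal_mono ?_ (hfin J))
    refine Set.biUnion_subset_biUnion_left fun p hp => ?_
    have := mem_fracs.1 hp
    exact ⟨(Finset.mem_Ico.1 this.1).1, this.2⟩
  exact lt_of_lt_of_le (by simp) (ge_of_tendsto' ht hge)

/-- A special case of Khinchin's theorem. -/
lemma ae_frequently_approx :
    ∀ᵐ α ∂(volume.restrict (Set.Ico (0 : ℝ) 1)),
      ∃ᶠ q : ℕ in atTop, ∃ m : ℤ, |(α : ℝ) - (m : ℝ) / q| < rad q := by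
  have hmp := UnitAddCircle.measurePreserving_mk 0
  rw [zero_add] at hmp
  have hIoc : volume.restrict (Set.Ico (0 : ℝ) 1) = volume.restrict (Set.Ioc (0 : ℝ) 1) :=
    Measure.restrict_congr_set Ico_ae_eq_Ioc
  rw [hIoc]
  rcases AddCircle.addWellApproximable_ae_empty_or_univ (T := 1) rad tendsto_rad with h | h
  · exfalso
    have h1 := hmp.quasiMeasurePreserving.ae h
    rw [ae_restrict_iff' measurableSet_Ioc] at h1
    refine volume_limsup_nbhd_pos.ne' (measure_mono_null ?_ h1)
    intro z hz
    rw [Set.mem_iInter] at hz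
    simp only [Set.mem_iUnion, Set.mem_ofPred_eq, exists_prop] at hz
    simp only [Set.mem_compl_iff, Set.mem_ofPred_eq]
    intro hcon
    obtain ⟨p, ⟨hp1, hp2, hp3⟩, hzp⟩ := hz 0
    have hzI := nbhd_subset (by omega) hp2 hp3 hzp
    refine hcon ⟨hzI.1, hzI.2.le⟩ ?_
    rw [UnitAddCircle.mem_addWellApproximable_iff, Set.infinite_iff_exists_gt]
    intro n
    obtain ⟨⟨q, x⟩, ⟨hq1, hq2, hq3⟩, hzq⟩ := hz n
    refine ⟨q, ⟨x, hq2, hq3.symm, ?_⟩, ?_⟩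
    · rw [nbhd, Metric.mem_ball, Real.dist_eq] at hzq
      rw [← AddCircle.coe_sub, UnitAddCircle.norm_eq]
      refine lt_of_le_of_lt ?_ hzq
      simpa using round_le (z - (x : ℝ) / q) 0
    · have : n + 1 < 4 ^ (n + 1) := Nat.lt_pow_self (by norm_num)
      simp only at hq1
      omega
  · filter_upwards [hmp.quasiMeasurePreserving.ae h] with α hα
    rw [UnitAddCircle.mem_addWellApproximable_iff] at hα
    rw [Nat.frequently_atTop_iff_infinite]
    refine hα.mono ?_
    rintro n ⟨m, hm, -, hlt⟩
    have hn : (n : ℝ) ≠ 0 := by exact_mod_cast (by omega : n ≠ 0)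
    rw [← AddCircle.coe_sub, UnitAddCircle.norm_eq] at hlt
    refine ⟨m + round (α - (m : ℝ) / n) * n, ?_⟩
    convert hlt using 2
    push_cast
    field_simp
    ring

lemma setOf_isSumTwoSquares_infinite : {n | IsSumTwoSquares n}.Infinite := by
  refine Set.infinite_of_injective_forall_mem (f := fun n : ℕ => n ^ 2)
    (fun m n h => Nat.pow_left_injective (by norm_num) h) fun n => ⟨n, 0, ?_⟩
  push_cast
  ring

lemma a_lt_a {n m : ℕ} (hn : 1 ≤ n) (h : n < m) : a n < a m :=
  Nat.nth_strictMono setOf_isSumTwoSquares_infinite (by omega)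

lemma a_le_a {n m : ℕ} (h : n ≤ m) : a n ≤ a m :=
  (Nat.nth_strictMono setOf_isSumTwoSquares_infinite).monotone (by omega)

lemma a_le_of_le_sum_b {M X : ℕ} (hM : 1 ≤ M) (h : M ≤ ∑ n ∈ Finset.Ioc 0 X, b n) : a M ≤ X := by
  have h1 : ∑ n ∈ Finset.Ioc 0 X, b n ≤ Nat.count IsSumTwoSquares (X + 1) := by
    rw [Nat.count_eq_card_filter_range]
    simp only [b]
    rw [← Finset.card_filter]
    refine Finset.card_le_card (Finset.filter_subset_filter _ fun x hx => ?_)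
    rw [Finset.mem_Ioc] at hx
    rw [Finset.mem_range]
    omega
  have h2 : a M < X + 1 := Nat.nth_lt_of_lt_count (by omega)
  omega

/-- Pigeonhole count of pairs lying in a common residue class. -/
lemma sq_le_mul_card_mod_eq (f : ℕ → ℕ) (S : Finset ℕ) {q : ℕ} (hq : 0 < q) :
    S.card ^ 2 ≤ q * ((S ×ˢ S).filter fun p => f p.1 % q = f p.2 % q).card := by
  have h1 : ((S ×ˢ S).filter fun p => f p.1 % q = f p.2 % q).card =
      ∑ r ∈ Finset.range q, (S.filter fun n => f n % q = r).card ^ 2 := by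
    rw [Finset.card_eq_sum_card_fiberwise (f := fun p : ℕ × ℕ => f p.1 % q)
      (t := Finset.range q) fun p _ => Finset.mem_coe.2 (Finset.mem_range.2 (Nat.mod_lt _ hq))]
    refine Finset.sum_congr rfl fun r _ => ?_
    rw [sq, ← Finset.card_product]
    congr 1
    ext ⟨n, m⟩
    simp only [Finset.mem_filter, Finset.mem_product]
    grind
  have h2 : S.card = ∑ r ∈ Finset.range q, (S.filter fun n => f n % q = r).card :=
    Finset.card_eq_sum_card_fiberwise fun p _ =>
      Finset.mem_coe.2 (Finset.mem_range.2 (Nat.mod_lt _ hq))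
  rw [h1, h2]
  simpa using sq_sum_le_card_mul_sum_sq (s := Finset.range q)
    (f := fun r => (S.filter fun n => f n % q = r).card)

lemma card_mod_eq_le (M q : ℕ) :
    ((Finset.Icc 1 M ×ˢ Finset.Icc 1 M).filter fun p => a p.1 % q = a p.2 % q).card ≤
      M + 2 * ((Finset.Icc 1 M ×ˢ Finset.Icc 1 M).filter
        fun p => p.1 < p.2 ∧ q ∣ a p.2 - a p.1).card := by
  set P := (Finset.Icc 1 M ×ˢ Finset.Icc 1 M).filter fun p => p.1 < p.2 ∧ q ∣ a p.2 - a p.1 with hP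
  have hsub : ((Finset.Icc 1 M ×ˢ Finset.Icc 1 M).filter fun p => a p.1 % q = a p.2 % q) ⊆
      ((Finset.Icc 1 M).image fun n => (n, n)) ∪ (P ∪ P.image Prod.swap) := by
    rintro ⟨n, m⟩ h
    simp only [Finset.mem_filter, Finset.mem_product] at h
    obtain ⟨⟨hn, hm⟩, he⟩ := h
    simp only [Finset.mem_union, Finset.mem_image, hP, Finset.mem_filter, Finset.mem_product]
    rcases lt_trichotomy n m with hlt | rfl | hlt
    · exact Or.inr (Or.inl ⟨⟨hn, hm⟩, hlt, (Nat.modEq_iff_dvd' (a_le_a hlt.le)).1 he⟩)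
    · exact Or.inl ⟨n, hn, rfl⟩
    · exact Or.inr (Or.inr
        ⟨(m, n), ⟨⟨hm, hn⟩, hlt, (Nat.modEq_iff_dvd' (a_le_a hlt.le)).1 he.symm⟩, rfl⟩)
  have h1 := Finset.card_le_card hsub
  have h2 := Finset.card_union_le ((Finset.Icc 1 M).image fun n => (n, n)) (P ∪ P.image Prod.swap)
  have h3 := Finset.card_union_le P (P.image Prod.swap)
  have h4 : (P.image Prod.swap).card ≤ P.card := Finset.card_image_le
  have h5 : ((Finset.Icc 1 M).image fun n => (n, n)).card ≤ (Finset.Icc 1 M).card :=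
    Finset.card_image_le
  rw [Nat.card_Icc] at h5
  omega

lemma card_dvd_eq_sum_R (M q : ℕ) :
    ((Finset.Icc 1 M ×ˢ Finset.Icc 1 M).filter fun p => p.1 < p.2 ∧ q ∣ a p.2 - a p.1).card =
      ∑ v ∈ (Finset.Icc 1 (a M)).filter (q ∣ ·), R M v := by
  rw [Finset.card_eq_sum_card_fiberwise (f := fun p : ℕ × ℕ => a p.2 - a p.1)
    (t := (Finset.Icc 1 (a M)).filter (q ∣ ·))]
  · refine Finset.sum_congr rfl fun v hv => ?_
    rw [R]
    congr 1
    ext p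
    have := (Finset.mem_filter.1 hv).2
    simp only [Finset.mem_filter]
    grind
  · rintro ⟨n, m⟩ h
    simp only [Finset.coe_filter, Set.mem_ofPred_eq, Finset.mem_product, Finset.mem_Icc] at h ⊢
    obtain ⟨⟨hn, hm⟩, hlt, hd⟩ := h
    have h1 := a_lt_a hn.1 hlt
    have h2 := a_le_a hm.2
    exact ⟨by omega, hd⟩

/-- If all multiples of `q` up to `a M` are good, pairs in a common residue class modulo `q`
make the pair correlation large. -/
lemma le_T_of_forall_dvd {α : ℝ} {M q : ℕ} (hM : 1 ≤ M) (hq : 0 < q)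
    (h : ∀ v, q ∣ v → v ≤ a M → nint (v * α) ≤ 1 / M) : ((M : ℝ) / q - 1) / 2 ≤ T α M 1 := by
  have hM' : (0 : ℝ) < M := by exact_mod_cast hM
  have hq' : (0 : ℝ) < q := by exact_mod_cast hq
  have h1 := sq_le_mul_card_mod_eq a (Finset.Icc 1 M) hq
  have h2 := card_mod_eq_le M q
  rw [card_dvd_eq_sum_R] at h2
  rw [Nat.card_Icc, Nat.add_sub_cancel] at h1
  have h3 : M ^ 2 ≤ q * (M + 2 * ∑ v ∈ (Finset.Icc 1 (a M)).filter (q ∣ ·), R M v) :=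
    h1.trans (Nat.mul_le_mul_left _ h2)
  have h4 : (M : ℝ) ^ 2 ≤
      q * (M + 2 * ∑ v ∈ (Finset.Icc 1 (a M)).filter (q ∣ ·), (R M v : ℝ)) := by
    exact_mod_cast h3
  have h5 : ∑ v ∈ (Finset.Icc 1 (a M)).filter (q ∣ ·), (R M v : ℝ) ≤
      ∑ v ∈ Finset.Icc 1 (a M), (R M v : ℝ) * (if nint (v * α) ≤ 1 / M then 1 else 0) := by
    rw [Finset.sum_filter]
    refine Finset.sum_le_sum fun v hv => ?_
    split_ifs with hd hn hn
    · simp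
    · exact absurd (h v hd (Finset.mem_Icc.1 hv).2) hn
    · simp
    · simp
  rw [T]
  set s := ∑ v ∈ Finset.Icc 1 (a M), (R M v : ℝ) * (if nint (v * α) ≤ 1 / M then 1 else 0)
  have h6 : (M : ℝ) ^ 2 ≤ q * (M + 2 * s) := h4.trans (by gcongr)
  have h7 : (M : ℝ) ^ 2 / q ≤ M + 2 * s := by rwa [div_le_iff₀' hq']
  calc ((M : ℝ) / q - 1) / 2 = 1 / M * ((M ^ 2 / q - M) / 2) := by field_simp
    _ ≤ 1 / M * s := by
      gcongr
      linarith

lemma nint_mul_le {α : ℝ} {q v : ℕ} {m : ℤ} (hq : 0 < q) (hv : q ∣ v) :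
    nint (v * α) ≤ v * |α - m / q| := by
  obtain ⟨k, rfl⟩ := hv
  have hq' : (q : ℝ) ≠ 0 := by positivity
  have h := round_le (((q * k : ℕ) : ℝ) * α) (k * m)
  refine h.trans (le_of_eq ?_)
  rw [← abs_of_nonneg (Nat.cast_nonneg (α := ℝ) (q * k)), ← abs_mul,
    abs_of_nonneg (Nat.cast_nonneg (α := ℝ) (q * k))]
  congr 1
  push_cast
  field_simp

lemma rad_le {q : ℕ} (hq : 2 ≤ q) : rad q ≤ 2 / (q ^ 2 * Real.log q) := by
  have hq' : (2 : ℝ) ≤ q := by exact_mod_cast hq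
  have hL : 0 < Real.log q := Real.log_pos (by linarith)
  have h := rad_mul_sq_le (q := q) (by omega)
  have h1 : (q : ℝ) ≤ 4 ^ (Nat.log 4 q + 1) := by
    exact_mod_cast (Nat.lt_pow_succ_log_self (by norm_num) q).le
  have h2 := Real.log_le_log (by linarith) h1
  rw [Real.log_pow, show (4 : ℝ) = 2 ^ 2 by norm_num, Real.log_pow] at h2
  push_cast at h2
  have h3 : Real.log q ≤ 2 * ((Nat.log 4 q : ℝ) + 1) := by
    have hj : (0 : ℝ) ≤ Nat.log 4 q := Nat.cast_nonneg _
    nlinarith [Real.log_two_lt_d9]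
  rw [le_div_iff₀ (by positivity)]
  have := rad_pos q
  calc rad q * (q ^ 2 * Real.log q) ≤ rad q * (q ^ 2 * (2 * ((Nat.log 4 q : ℝ) + 1))) := by gcongr
    _ = 2 * (rad q * q ^ 2 * ((Nat.log 4 q : ℝ) + 1)) := by ring
    _ ≤ 2 := by linarith

/-- The lower bound for the number of sums of two squares at the scale `q * (log q) ^ (7 / 8)`,
where `y = (log q) ^ (1 / 8)`. -/
lemma mul_le_sum_b {c : ℝ} (hc : 0 < c)
    (h : ∀ N : ℕ, 2 ≤ N → c * (N * Real.log N ^ ((1 : ℝ) / 4)) ≤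
      (∑ n ∈ Finset.Ioc 0 N, (b n : ℝ)) * Real.log N)
    {q : ℕ} (hq : 2 ≤ q) {y : ℝ} (hy : 1 ≤ y) (hL : Real.log q = y ^ 8) :
    c / 16 * (q * y) ≤ ∑ n ∈ Finset.Ioc 0 ⌊q * y ^ 7⌋₊, (b n : ℝ) := by
  have hq' : (2 : ℝ) ≤ q := by exact_mod_cast hq
  have hy7 : 1 ≤ y ^ 7 := one_le_pow₀ hy
  have hqy : (2 : ℝ) ≤ q * y ^ 7 := by nlinarith
  set X := ⌊(q : ℝ) * y ^ 7⌋₊ with hX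
  have hX2 : 2 ≤ X := Nat.le_floor (by exact_mod_cast hqy)
  have hX2' : (2 : ℝ) ≤ X := by exact_mod_cast hX2
  have hXle : (X : ℝ) ≤ q * y ^ 7 := Nat.floor_le (by positivity)
  have hXge : q * y ^ 7 / 2 ≤ X := by
    have := Nat.lt_floor_add_one ((q : ℝ) * y ^ 7)
    rw [← hX] at this
    linarith
  have hlogq : Real.log q ≤ q := by
    linarith [Real.log_le_sub_one_of_pos (show (0 : ℝ) < q by linarith)]
  have hlogX : Real.log X ≤ 2 * y ^ 8 := by
    have h1 : (X : ℝ) ≤ q ^ 2 := by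
      have : y ^ 7 ≤ y ^ 8 := pow_le_pow_right₀ hy (by norm_num)
      nlinarith
    have h2 := Real.log_le_log (by linarith) h1
    rw [Real.log_pow, hL] at h2
    exact_mod_cast h2
  have hlogX0 : 0 < Real.log X := Real.log_pos (by linarith)
  have hN := h X hX2
  set z := Real.log X ^ ((1 : ℝ) / 4) with hz
  have hz0 : 0 < z := Real.rpow_pos_of_pos hlogX0 _
  have hz4 : Real.log X = z ^ 4 := by
    rw [hz, ← Real.rpow_natCast, ← Real.rpow_mul hlogX0.le]
    norm_num
  have hzy : z ≤ 2 * y ^ 2 := by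
    refine le_of_pow_le_pow_left₀ (n := 4) (by norm_num) (by positivity) ?_
    have : (2 * y ^ 2) ^ 4 = 16 * y ^ 8 := by ring
    rw [← hz4, this]
    nlinarith [pow_pos (show 0 < y by linarith) 8]
  set B := ∑ n ∈ Finset.Ioc 0 X, (b n : ℝ)
  have hB0 : 0 ≤ B := Finset.sum_nonneg fun _ _ => Nat.cast_nonneg _
  have h1 : c * X ≤ B * z ^ 3 := by
    rw [hz4] at hN
    refine le_of_mul_le_mul_right ?_ hz0
    calc c * X * z = c * (X * z) := by ring
      _ ≤ B * z ^ 4 := hN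
      _ = _ := by ring
  have h2 : B * z ^ 3 ≤ B * (8 * y ^ 6) := by
    have : z ^ 3 ≤ (2 * y ^ 2) ^ 3 := by gcongr
    calc _ ≤ B * (2 * y ^ 2) ^ 3 := by gcongr
      _ = _ := by ring
  have h3 : c * (q * y ^ 7 / 2) ≤ c * X := by gcongr
  refine le_of_mul_le_mul_right ?_ (show 0 < 8 * y ^ 6 by positivity)
  calc c / 16 * (q * y) * (8 * y ^ 6) = c * (q * y ^ 7 / 2) := by ring
    _ ≤ _ := h3.trans (h1.trans h2)

lemma le_T_of_approx {c δ : ℝ} (hc : 0 < c)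
    (h : ∀ N : ℕ, 2 ≤ N → c * (N * Real.log N ^ ((1 : ℝ) / 4)) ≤
      (∑ n ∈ Finset.Ioc 0 N, (b n : ℝ)) * Real.log N)
    (hδc : δ ≤ c / 160) (hδ : δ ≤ 1 / 20)
    {q : ℕ} (hq : 2 ≤ q) {y : ℝ} (hy : 1 ≤ y) (hL : Real.log q = y ^ 8) (hδy : 2 ≤ δ * y)
    {α : ℝ} {m : ℤ} (hα : |α - m / q| < rad q) :
    δ * y ≤ T α (10 * ⌊q * (δ * y)⌋₊) 1 := by
  have hq' : (2 : ℝ) ≤ q := by exact_mod_cast hq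
  set N := ⌊(q : ℝ) * (δ * y)⌋₊ with hN
  have hNle : (N : ℝ) ≤ q * (δ * y) := Nat.floor_le (by positivity)
  have hNge : q * (δ * y) - 1 ≤ N := (Nat.sub_one_lt_floor _).le
  have hN1 : 1 ≤ N := Nat.le_floor (by push_cast; nlinarith)
  have hqy : 0 < (q : ℝ) * y := by positivity
  have hδ0 : 0 < δ := by
    by_contra hneg
    nlinarith
  have hM : ((10 * N : ℕ) : ℝ) ≤ 10 * (q * (δ * y)) := by
    push_cast
    linarith
  have hM0 : (0 : ℝ) < ((10 * N : ℕ) : ℝ) := by exact_mod_cast (by omega : 0 < 10 * N)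
  have haX : a (10 * N) ≤ ⌊(q : ℝ) * y ^ 7⌋₊ := by
    refine a_le_of_le_sum_b (by omega) ?_
    have h1 := mul_le_sum_b hc h hq hy hL
    have h2 : ((10 * N : ℕ) : ℝ) ≤ ∑ n ∈ Finset.Ioc 0 ⌊(q : ℝ) * y ^ 7⌋₊, (b n : ℝ) :=
      calc ((10 * N : ℕ) : ℝ) ≤ (10 * δ) * (q * y) := by linarith
        _ ≤ c / 16 * (q * y) := by
          gcongr
          linarith
        _ ≤ _ := h1
    exact_mod_cast h2
  have hgood : ∀ v, q ∣ v → v ≤ a (10 * N) → nint (v * α) ≤ 1 / ((10 * N : ℕ) : ℝ) := by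
    intro v hv hva
    have h1 : (v : ℝ) ≤ q * y ^ 7 :=
      le_trans (by exact_mod_cast hva.trans haX) (Nat.floor_le (by positivity))
    have h2 := rad_le hq
    rw [hL] at h2
    calc nint (v * α) ≤ v * |α - m / q| := nint_mul_le (by omega) hv
      _ ≤ (q * y ^ 7) * (2 / (q ^ 2 * y ^ 8)) := by
        gcongr
        exact hα.le.trans h2
      _ = 2 / (q * y) := by field_simp
      _ ≤ 1 / (10 * (q * (δ * y))) := by
        rw [div_le_div_iff₀ (by positivity) (by positivity)]
        nlinarith
      _ ≤ _ := by gcongr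
  have hT := le_T_of_forall_dvd (by omega) (by omega) hgood
  refine le_trans ?_ hT
  have hdiv : 10 * (δ * y) - 5 ≤ ((10 * N : ℕ) : ℝ) / q := by
    rw [le_div_iff₀ (by linarith)]
    push_cast
    nlinarith
  linarith

lemma log_floor_rpow_le {δ : ℝ} (hδ0 : 0 < δ) (hδ : δ ≤ 1 / 20) {q : ℕ} (hq : 2 ≤ q) {y : ℝ}
    (hy : 1 ≤ y) (hL : Real.log q = y ^ 8) :
    Real.log ⌊q * (δ * y)⌋₊ ^ ((1 : ℝ) / 10) ≤ 2 * y := by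
  have hq' : (2 : ℝ) ≤ q := by exact_mod_cast hq
  have hlogq : Real.log q ≤ q := by
    linarith [Real.log_le_sub_one_of_pos (show (0 : ℝ) < q by linarith)]
  set N := ⌊(q : ℝ) * (δ * y)⌋₊
  have hNle : (N : ℝ) ≤ q * (δ * y) := Nat.floor_le (by positivity)
  have hy8 : y ≤ y ^ 8 := le_self_pow₀ hy (by norm_num)
  have h1 : (N : ℝ) ≤ q ^ 2 := by
    have : δ * y ≤ q := by nlinarith
    nlinarith
  have h2 : Real.log N ≤ (2 * y) ^ (10 : ℕ) := by
    have hp : y ^ 8 ≤ y ^ 10 := pow_le_pow_right₀ hy (by norm_num)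
    have hp0 : 0 < y ^ 10 := by positivity
    have hle : 2 * y ^ 8 ≤ (2 * y) ^ (10 : ℕ) := by
      rw [mul_pow]
      nlinarith
    refine le_trans ?_ hle
    rcases Nat.eq_zero_or_pos N with h0 | h0
    · rw [h0]
      simp only [Nat.cast_zero, Real.log_zero]
      positivity
    · have h3 := Real.log_le_log (by exact_mod_cast h0) h1
      rw [Real.log_pow, hL] at h3
      exact_mod_cast h3
  calc Real.log N ^ ((1 : ℝ) / 10) ≤ ((2 * y) ^ (10 : ℕ)) ^ ((1 : ℝ) / 10) := by
        exact Real.rpow_le_rpow (Real.log_natCast_nonneg N) h2 (by norm_num)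
    _ = 2 * y := by
        rw [← Real.rpow_natCast, ← Real.rpow_mul (by positivity)]
        norm_num

lemma exists_frequently_le_T :
    ∃ c : ℝ, 0 < c ∧ ∀ α : ℝ, (∃ᶠ q : ℕ in atTop, ∃ m : ℤ, |α - (m : ℝ) / q| < rad q) →
      ∃ᶠ N : ℕ in atTop, c * Real.log N ^ ((1 : ℝ) / 10) ≤ T α (10 * N) 1 := by
  obtain ⟨c, hc, h⟩ := exists_le_sum_b
  set δ := min (c / 160) (1 / 20) with hδ
  have hδ0 : 0 < δ := by positivity
  refine ⟨δ / 2, by positivity, fun α hα => ?_⟩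
  have hlog : Tendsto (fun q : ℕ => Real.log q ^ ((1 : ℝ) / 8)) atTop atTop :=
    (tendsto_rpow_atTop (by norm_num)).comp
      (Real.tendsto_log_atTop.comp tendsto_natCast_atTop_atTop)
  have hδlog : Tendsto (fun q : ℕ => δ * Real.log q ^ ((1 : ℝ) / 8)) atTop atTop :=
    hlog.const_mul_atTop hδ0
  have hN : Tendsto (fun q : ℕ => ⌊q * (δ * Real.log q ^ ((1 : ℝ) / 8))⌋₊) atTop atTop :=
    tendsto_nat_floor_atTop.comp (tendsto_natCast_atTop_atTop.atTop_mul_atTop₀ hδlog)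
  refine hN.frequently ((hα.and_eventually ((eventually_ge_atTop 2).and
    ((hlog.eventually_ge_atTop 1).and (hδlog.eventually_ge_atTop 2)))).mono ?_)
  rintro q ⟨⟨m, hm⟩, hq, hy, hδy⟩
  set y := Real.log q ^ ((1 : ℝ) / 8) with hyq
  have hL : Real.log q = y ^ 8 := by
    rw [hyq, ← Real.rpow_natCast, ← Real.rpow_mul (Real.log_natCast_nonneg q)]
    norm_num
  have h1 := le_T_of_approx hc h (min_le_left _ _) (min_le_right _ _) hq hy hL hδy hm
  have h2 := log_floor_rpow_le hδ0 (min_le_right _ _) hq hy hL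
  calc _ ≤ δ / 2 * (2 * y) := by gcongr
    _ = δ * y := by ring
    _ ≤ _ := h1

lemma limsup_T_eq_top {c α : ℝ} (hc : 0 < c)
    (h : ∃ᶠ N : ℕ in atTop, c * Real.log N ^ ((1 : ℝ) / 10) ≤ T α (10 * N) 1) :
    Filter.limsup (fun N : ℕ => ((T α N 1 : ℝ) : EReal)) atTop = ⊤ := by
  rw [EReal.eq_top_iff_forall_lt]
  intro r
  have hlog : Tendsto (fun N : ℕ => c * Real.log N ^ ((1 : ℝ) / 10)) atTop atTop :=
    ((tendsto_rpow_atTop (by norm_num)).comp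
      (Real.tendsto_log_atTop.comp tendsto_natCast_atTop_atTop)).const_mul_atTop hc
  have h10 : Tendsto (fun N : ℕ => 10 * N) atTop atTop :=
    tendsto_id.const_mul_atTop' (by norm_num)
  have hfr : ∃ᶠ N : ℕ in atTop, ((r + 1 : ℝ) : EReal) ≤ ((T α N 1 : ℝ) : EReal) := by
    refine h10.frequently ((h.and_eventually (hlog.eventually_ge_atTop (r + 1))).mono ?_)
    rintro N ⟨h1, h2⟩
    exact EReal.coe_le_coe_iff.2 (h2.trans h1)
  refine lt_of_lt_of_le ?_ (le_limsup_of_frequently_le hfr)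
  exact EReal.coe_lt_coe_iff.2 (by linarith)

/-- There is a constant `c > 0` such that for almost every `α ∈ [0,1)` there are
infinitely many `N` with `T(α, 10N, 1) ≥ c (log N)^{1/10}`; in particular, for almost
every `α`, `limsup_N T(α,N,1) = ∞`, so there is no Poissonian pair correlation a.e. -/
theorem exists_frequently_T_large :
    ∃ c : ℝ, 0 < c ∧
      ∀ᵐ α ∂(volume.restrict (Set.Ico (0:ℝ) 1)),
        (∃ᶠ N : ℕ in atTop, c * Real.log N ^ ((1:ℝ)/10) ≤ T α (10 * N) 1) ∧
        Filter.limsup (fun N : ℕ => ((T α N 1 : ℝ) : EReal)) atTop = ⊤ := by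
  obtain ⟨c, hc, h⟩ := exists_frequently_le_T
  refine ⟨c, hc, ?_⟩
  filter_upwards [ae_frequently_approx] with α hα
  exact ⟨h α hα, limsup_T_eq_top hc (h α hα)⟩
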